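/- arXiv:1912.00710 — 2 statements merged into one kernel-verified Lean document; each statement's English description precedes it below -/
import Mathlib

section
/- There exists a polynomial f : ℕ → ℕ such that every tournament T that is strongly (2k+1)-connected and has minimum out-degree at least f(k) is k-linked. -/
/-- A tournament: a loopless digraph on a finite vertex set in which, for every pair of
distinct vertices `x, y`, exactly one of the edges `(x,y)`, `(y,x)` is present. -/
def IsTournament {V : Type} (G : V → V → Prop) : Prop :=
  (∀ v, ¬ G v v) ∧ ∀ x y : V, x ≠ y → (G x y ↔ ¬ G y x)

/-- A directed path: a nonempty list of pairwise distinct vertices in which consecutive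
vertices are joined by a directed edge. -/
def IsDipath {V : Type} (G : V → V → Prop) (p : List V) : Prop :=
  p ≠ [] ∧ p.Nodup ∧ p.Chain' G

/-- The out-degree of a vertex. -/
noncomputable def outDeg {V : Type} (G : V → V → Prop) (v : V) : ℕ := {u | G v u}.ncard

/-- The in-degree of a vertex. -/
noncomputable def inDeg {V : Type} (G : V → V → Prop) (v : V) : ℕ := {u | G u v}.ncard

/-- A digraph is strongly `k`-connected if it has at least `k+1` vertices and, after removing
any set `S` of at most `k-1` vertices, any vertex can reach any other by a directed path
avoiding `S`. -/
def StronglyKConnected {V : Type} [Fintype V] (G : V → V → Prop) (k : ℕ) : Prop :=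
  k + 1 ≤ Fintype.card V ∧
  ∀ S : Set V, S.ncard ≤ k - 1 → ∀ x y : V, x ∉ S → y ∉ S → x ≠ y →
    ∃ p : List V, IsDipath G p ∧ p.head? = some x ∧ p.getLast? = some y ∧ ∀ v ∈ p, v ∉ S

/-- A digraph is `k`-linked if it has at least `2k` vertices and for any `2k` distinct
vertices `x₁, …, x_k, y₁, …, y_k` there are pairwise vertex-disjoint directed paths
`P₁, …, P_k` with `P i` starting at `x i` and ending at `y i`. -/
def KLinked {V : Type} [Fintype V] (G : V → V → Prop) (k : ℕ) : Prop :=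
  2 * k ≤ Fintype.card V ∧
  ∀ x y : Fin k → V, Function.Injective (Sum.elim x y : Fin k ⊕ Fin k → V) →
    ∃ P : Fin k → List V,
      (∀ i, IsDipath G (P i) ∧ (P i).head? = some (x i) ∧ (P i).getLast? = some (y i)) ∧
      ∀ i j, i ≠ j → ∀ v ∈ P i, v ∉ P j

section LinkedAux

set_option linter.unusedSectionVars false
set_option linter.unusedDecidableInType false
set_option linter.unusedFintypeInType false

/-- A relation that is total on a finite set has a vertex of large in-degree. -/
lemma exists_large_indeg {α : Type} [DecidableEq α] (I : Finset α) (E : α → α → Prop)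
    [DecidableRel E] (hI : I.Nonempty) (hE : ∀ a ∈ I, ∀ b ∈ I, a ≠ b → E a b ∨ E b a) :
    ∃ b ∈ I, I.card ≤ 2 * (I.filter (fun a => E a b)).card + 1 := by
  by_contra hcon
  push Not at hcon
  have h1 : ∑ b ∈ I, (2 * (I.filter (fun a => E a b)).card + 1) + I.card ≤ ∑ b ∈ I, I.card := by
    have : ∑ b ∈ I, (2 * (I.filter (fun a => E a b)).card + 1 + 1) ≤ ∑ b ∈ I, I.card :=
      Finset.sum_le_sum fun b hb => hcon b hb
    simp only [Finset.sum_add_distrib, Finset.sum_const, smul_eq_mul, mul_one] at this ⊢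
    omega
  have h2 : ∑ b ∈ I, (I.filter (fun a => E a b)).card
      = ∑ b ∈ I, (I.filter (fun a => E b a)).card := by
    simp only [Finset.card_filter]
    rw [Finset.sum_comm]
  have h3 : ∀ b ∈ I, I.card ≤ (I.filter (fun a => E a b)).card
      + (I.filter (fun a => E b a)).card + 1 := by
    intro b hb
    have : I ⊆ (I.filter (fun a => E a b) ∪ I.filter (fun a => E b a)) ∪ {b} := by
      intro a ha
      by_cases hab : a = b
      · simp [hab]
      · rcases hE a ha b hb hab with h | h <;> simp [ha, h]
    refine (Finset.card_le_card this).trans ?_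
    refine (Finset.card_union_le _ _).trans ?_
    have := Finset.card_union_le (I.filter (fun a => E a b)) (I.filter (fun a => E b a))
    simp only [Finset.card_singleton]
    omega
  have h4 := Finset.sum_le_sum h3
  simp only [Finset.sum_add_distrib, ← Finset.mul_sum] at h1 h4
  rw [← h2] at h4
  have : 0 < I.card := hI.card_pos
  omega

variable {V : Type} [Fintype V] [DecidableEq V]

/-- A cut of order at most `s`: a pair of disjoint sets with no edges from the first to the
second, and at most `s` further vertices. -/
def IsCut (G : V → V → Prop) (s : ℕ) (C : Finset V × Finset V) : Prop :=
  Disjoint C.1 C.2 ∧ (∀ a ∈ C.1, ∀ b ∈ C.2, ¬ G a b) ∧ ((C.1 ∪ C.2)ᶜ).card ≤ s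

/-- `w` is an essential vertex of the separator of the cut `C`. -/
def Ess (G : V → V → Prop) (s : ℕ) (C : Finset V × Finset V) (w : V) : Prop :=
  IsCut G s C ∧ w ∉ C.1 ∧ w ∉ C.2 ∧ (∃ p ∈ C.1, G p w) ∧ ∃ q ∈ C.2, G w q

/-- The height of a cut. -/
def ht (C : Finset V × Finset V) : ℤ := (C.1.card : ℤ) - C.2.card

lemma IsTournament.flip {G : V → V → Prop} (hG : IsTournament G) :
    IsTournament (fun a b => G b a) :=
  ⟨hG.1, fun x y h => hG.2 y x h.symm⟩

lemma IsTournament.of_not {G : V → V → Prop} (hG : IsTournament G) {a b : V} (hab : a ≠ b)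
    (h : ¬ G a b) : G b a := by
  by_contra h'
  exact h ((hG.2 a b hab).2 h')

lemma IsTournament.asymm {G : V → V → Prop} (hG : IsTournament G) {a b : V}
    (h : G a b) : ¬ G b a := by
  have hab : a ≠ b := by
    rintro rfl
    exact hG.1 _ h
  exact (hG.2 a b hab).1 h

lemma IsCut.flip {G : V → V → Prop} {s : ℕ} {C : Finset V × Finset V} (h : IsCut G s C) :
    IsCut (fun a b => G b a) s C.swap := by
  refine ⟨h.1.symm, fun a ha b hb => h.2.1 b hb a ha, ?_⟩
  have := h.2.2
  rwa [Finset.union_comm] at this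

lemma Ess.flip {G : V → V → Prop} {s : ℕ} {C : Finset V × Finset V} {w : V} (h : Ess G s C w) :
    Ess (fun a b => G b a) s C.swap w :=
  ⟨h.1.flip, h.2.2.1, h.2.1, h.2.2.2.2, h.2.2.2.1⟩

lemma cut_nest {G : V → V → Prop} (hG : IsTournament G) {s : ℕ} {C D : Finset V × Finset V}
    (hC : IsCut G s C) (hD : IsCut G s D) : Disjoint C.1 D.2 ∨ Disjoint D.1 C.2 := by
  by_contra hcon
  push Not at hcon
  obtain ⟨h1, h2⟩ := hcon
  rw [Finset.not_disjoint_iff] at h1 h2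
  obtain ⟨z, hz1, hz2⟩ := h1
  obtain ⟨y, hy1, hy2⟩ := h2
  have hzy : z ≠ y := by
    rintro rfl
    exact Finset.disjoint_left.1 hC.1 hz1 hy2
  exact hD.2.1 y hy1 z hz2 (hG.of_not hzy (hC.2.1 z hz1 y hy2))

lemma mem_sep {C : Finset V × Finset V} {v : V} : v ∈ (C.1 ∪ C.2)ᶜ ↔ v ∉ C.1 ∧ v ∉ C.2 := by
  simp

/-- The bound for vertices sharing an in-neighbour on the left. -/
lemma common_left {G : V → V → Prop} (hG : IsTournament G) {s : ℕ} (I : Finset V)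
    (C : V → Finset V × Finset V) (p : V)
    (hC : ∀ w ∈ I, Ess G s (C w) w) (hp : ∀ w ∈ I, p ∈ (C w).1 ∧ G p w) :
    I.card ≤ 2 * (s + s * s) + 1 := by
  classical
  rcases I.eq_empty_or_nonempty with rfl | hI
  · simp
  have hr : ∀ w, ∃ r, w ∈ I → r ∈ (C w).2 ∧ G w r := by
    intro w
    by_cases hw : w ∈ I
    · obtain ⟨r, hr⟩ := (hC w hw).2.2.2.2
      exact ⟨r, fun _ => hr⟩
    · exact ⟨w, fun h => absurd h hw⟩
  choose r hr using hr
  -- every vertex of `I` avoids the right side of every cut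
  have hside : ∀ w ∈ I, ∀ w' ∈ I, w ∉ (C w').2 := by
    intro w hw w' hw' h
    exact (hC w' hw').1.2.1 p (hp w' hw').1 w h (hp w hw).2
  let E : V → V → Prop := fun w w' => w ∈ ((C w').1 ∪ (C w').2)ᶜ ∨ r w ∈ ((C w').1 ∪ (C w').2)ᶜ
  have key : ∀ w ∈ I, ∀ w' ∈ I, Disjoint (C w').1 (C w).2 → E w w' := by
    intro w hw w' hw' hd
    by_cases h1 : w ∈ ((C w').1 ∪ (C w').2)ᶜ
    · exact Or.inl h1
    · right
      rw [mem_sep] at h1 ⊢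
      have h2 := hside w hw w' hw'
      have h3 : w ∈ (C w').1 := by tauto
      refine ⟨fun h => Finset.disjoint_left.1 hd h (hr w hw).1, fun h => ?_⟩
      exact (hC w' hw').1.2.1 w h3 _ h (hr w hw).2
  obtain ⟨b, hb, hcard⟩ := exists_large_indeg I E hI (by
    intro a ha b hb _
    rcases cut_nest hG (hC a ha).1 (hC b hb).1 with h | h
    · exact Or.inr (key b hb a ha h)
    · exact Or.inl (key a ha b hb h))
  have hS := (hC b hb).1.2.2
  set S := ((C b).1 ∪ (C b).2)ᶜ with hSdef
  have h1 : (I.filter (fun a => E a b)).card ≤ s + s * s := by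
    have hsub : I.filter (fun a => E a b) ⊆ S ∪ I.filter (fun a => r a ∈ S) := by
      intro a ha
      rw [Finset.mem_filter] at ha
      rcases ha.2 with h | h
      · exact Finset.mem_union_left _ h
      · exact Finset.mem_union_right _ (Finset.mem_filter.2 ⟨ha.1, h⟩)
    refine (Finset.card_le_card hsub).trans ((Finset.card_union_le _ _).trans ?_)
    refine add_le_add hS ?_
    refine (Finset.card_le_mul_card_image_of_maps_to (f := r) (t := S) (n := s) ?_ ?_).trans ?_
    · intro a ha
      exact (Finset.mem_filter.1 ha).2
    · intro q _
      rcases (Finset.filter (fun a => r a = q) (I.filter (fun a => r a ∈ S))).eq_empty_or_nonempty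
        with h | ⟨a, ha⟩
      · simp [h]
      · simp only [Finset.mem_filter] at ha
        refine le_trans (Finset.card_le_card ?_) (hC a ha.1.1).1.2.2
        intro w hw
        simp only [Finset.mem_filter] at hw
        rw [mem_sep]
        refine ⟨fun h => ?_, hside w hw.1.1 a ha.1.1⟩
        have h5 := (hr a ha.1.1).1
        rw [ha.2] at h5
        have h6 := (hr w hw.1.1).2
        rw [hw.2] at h6
        exact (hC a ha.1.1).1.2.1 w h q h5 h6
    · exact Nat.mul_le_mul_left _ hS
  omega

/-- The constant of `common_left`. -/
def cz (s : ℕ) : ℕ := 2 * (s + s * s) + 1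

/-- The constant of `position_left`. -/
def cone (s : ℕ) : ℕ := s + s * cz s + (2 * (2 * s * cz s) + 1)

lemma card_inter_bound {s : ℕ} {C D : Finset V × Finset V} (hC : Disjoint C.1 C.2)
    (hD : Disjoint D.1 D.2)
    (hCs : ((C.1 ∪ C.2)ᶜ).card ≤ s) (hDs : ((D.1 ∪ D.2)ᶜ).card ≤ s) (hCD : Disjoint C.1 D.2)
    (hht : ht D ≤ ht C) : (D.1 ∩ C.2).card ≤ s := by
  have h1 : C.1.card ≤ (C.1 ∩ D.1).card + s := by
    refine le_trans (Finset.card_le_card (t := (C.1 ∩ D.1) ∪ (D.1 ∪ D.2)ᶜ) ?_)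
      ((Finset.card_union_le _ _).trans (by omega))
    intro v hv
    have := Finset.disjoint_left.1 hCD hv
    by_cases h : v ∈ D.1 <;> simp [hv, h, this]
  have h2 : D.2.card ≤ (C.2 ∩ D.2).card + s := by
    refine le_trans (Finset.card_le_card (t := (C.2 ∩ D.2) ∪ (C.1 ∪ C.2)ᶜ) ?_)
      ((Finset.card_union_le _ _).trans (by omega))
    intro v hv
    have := Finset.disjoint_right.1 hCD hv
    by_cases h : v ∈ C.2 <;> simp [hv, h, this]
  have h3 : (C.1 ∩ D.1).card + (D.1 ∩ C.2).card ≤ D.1.card := by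
    rw [← Finset.card_union_of_disjoint]
    · exact Finset.card_le_card (by intro v; simp; tauto)
    · rw [Finset.disjoint_left]
      intro v hv hv'
      simp only [Finset.mem_inter] at hv hv'
      exact Finset.disjoint_left.1 hC hv.1 hv'.2
  have h4 : (C.2 ∩ D.2).card + (D.1 ∩ C.2).card ≤ C.2.card := by
    rw [← Finset.card_union_of_disjoint]
    · exact Finset.card_le_card (by intro v; simp; tauto)
    · rw [Finset.disjoint_left]
      intro v hv hv'
      simp only [Finset.mem_inter] at hv hv'
      exact Finset.disjoint_left.1 hD hv'.1 hv.2
  unfold ht at hht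
  omega

/-- Vertices which are essential in lower cuts mostly lie on the left. -/
lemma position_left {G : V → V → Prop} (hG : IsTournament G) {s : ℕ} (I : Finset V)
    (C : V → Finset V × Finset V) (D : Finset V × Finset V) (hD : IsCut G s D)
    (hC : ∀ w ∈ I, Ess G s (C w) w) (hh : ∀ w ∈ I, ht (C w) ≤ ht D)
    (hout : ∀ w ∈ I, w ∉ D.1) : I.card ≤ cone s := by
  classical
  have hp : ∀ w, ∃ p, w ∈ I → p ∈ (C w).1 ∧ G p w := by
    intro w
    by_cases hw : w ∈ I
    · obtain ⟨r, hr⟩ := (hC w hw).2.2.2.1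
      exact ⟨r, fun _ => hr⟩
    · exact ⟨w, fun h => absurd h hw⟩
  choose p hp using hp
  -- pigeonhole
  have pig : ∀ J ⊆ I, ∀ A : Finset V, (∀ w ∈ J, p w ∈ A) → J.card ≤ A.card * cz s := by
    intro J hJ A hA
    rw [mul_comm]
    refine Finset.card_le_mul_card_image_of_maps_to (f := p) hA _ ?_
    intro q _
    refine common_left hG _ C q ?_ ?_
    · intro w hw
      exact hC w (hJ (Finset.mem_filter.1 hw).1)
    · intro w hw
      rw [Finset.mem_filter] at hw
      have := hp w (hJ hw.1)
      rwa [hw.2] at this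
  set S := (D.1 ∪ D.2)ᶜ with hS
  set I₁ := I.filter (fun w => p w ∈ S) with hI₁
  set I₂ := I.filter (fun w => w ∈ D.2 ∧ p w ∈ D.2) with hI₂
  have hcov : I ⊆ (S ∪ I₁) ∪ I₂ := by
    intro w hw
    by_cases h1 : w ∈ D.2
    · by_cases h2 : p w ∈ D.2
      · simp [hI₂, hw, h1, h2]
      · have h3 : p w ∈ S := by
          rw [hS, mem_sep]
          exact ⟨fun h => hD.2.1 _ h w h1 (hp w hw).2, h2⟩
        refine Finset.mem_union_left _ (Finset.mem_union_right _ ?_)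
        rw [hI₁, Finset.mem_filter]
        exact ⟨hw, h3⟩
    · refine Finset.mem_union_left _ (Finset.mem_union_left _ ?_)
      rw [hS, mem_sep]
      exact ⟨hout w hw, h1⟩
  have b1 : I₁.card ≤ s * cz s :=
    (pig I₁ (Finset.filter_subset _ _) S (fun w hw => (Finset.mem_filter.1 hw).2)).trans
      (Nat.mul_le_mul_right _ hD.2.2)
  have b2 : I₂.card ≤ 2 * (2 * s * cz s) + 1 := by
    rcases I₂.eq_empty_or_nonempty with h | hne
    · simp [h]
    have hsub : I₂ ⊆ I := Finset.filter_subset _ _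
    obtain ⟨b, hb, hcard⟩ := exists_large_indeg I₂ (fun w w' => Disjoint (C w).1 (C w').2) hne
      (fun a ha b hb _ => cut_nest hG (hC a (hsub ha)).1 (hC b (hsub hb)).1)
    have hbI := hsub hb
    have hb2 := (Finset.mem_filter.1 hb).2
    have hnd : Disjoint D.1 (C b).2 := by
      rcases cut_nest hG hD (hC b hbI).1 with h | h
      · exact h
      · exact absurd hb2.2 (Finset.disjoint_left.1 h (hp b hbI).1)
    have hc := card_inter_bound hD.1 (hC b hbI).1.1 hD.2.2 (hC b hbI).1.2.2 hnd (hh b hbI)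
    have := pig (I₂.filter (fun w => Disjoint (C w).1 (C b).2))
      ((Finset.filter_subset _ _).trans hsub) (((C b).1 ∩ D.2) ∪ ((C b).1 ∪ (C b).2)ᶜ) (by
        intro w hw
        rw [Finset.mem_filter] at hw
        have h1 := (Finset.mem_filter.1 hw.1).2.2
        have h2 := Finset.disjoint_left.1 hw.2 (hp w (hsub hw.1)).1
        by_cases h3 : p w ∈ (C b).1 <;> simp [h1, h2, h3])
    have h5 : (((C b).1 ∩ D.2) ∪ ((C b).1 ∪ (C b).2)ᶜ).card ≤ 2 * s := by
      refine (Finset.card_union_le _ _).trans ?_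
      have := (hC b hbI).1.2.2
      omega
    have h6 := this.trans (Nat.mul_le_mul_right _ h5)
    omega
  have := Finset.card_le_card hcov
  have h7 := Finset.card_union_le (S ∪ I₁) I₂
  have h8 := Finset.card_union_le S I₁
  have h9 : S.card ≤ s := hD.2.2
  unfold cone
  omega

lemma position_right {G : V → V → Prop} (hG : IsTournament G) {s : ℕ} (I : Finset V)
    (C : V → Finset V × Finset V) (D : Finset V × Finset V) (hD : IsCut G s D)
    (hC : ∀ w ∈ I, Ess G s (C w) w) (hh : ∀ w ∈ I, ht D ≤ ht (C w))
    (hout : ∀ w ∈ I, w ∉ D.2) : I.card ≤ cone s := by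
  refine position_left hG.flip I (fun w => (C w).swap) D.swap hD.flip
    (fun w hw => (hC w hw).flip) (fun w hw => ?_) hout
  have := hh w hw
  simp only [ht, Prod.fst_swap, Prod.snd_swap] at this ⊢
  omega


/-- Two distinct vertices are bad if they are essential in a common cut. -/
def Bad (G : V → V → Prop) (s : ℕ) (w w' : V) : Prop :=
  w ≠ w' ∧ ∃ C, Ess G s C w ∧ Ess G s C w'

lemma Bad.symm {G : V → V → Prop} {s : ℕ} {w w' : V} (h : Bad G s w w') : Bad G s w' w := by
  obtain ⟨h1, C, h2, h3⟩ := h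
  exact ⟨h1.symm, C, h3, h2⟩

/-- `m` selects for every vertex a highest cut in which the vertex is essential. -/
def IsTopCut (G : V → V → Prop) (s : ℕ) (m : V → Finset V × Finset V) : Prop :=
  ∀ w C, Ess G s C w → Ess G s (m w) w ∧ ht C ≤ ht (m w)

lemma exists_top (G : V → V → Prop) (s : ℕ) : ∃ m, IsTopCut G s m := by
  classical
  have : ∀ w, ∃ D, ∀ C, Ess G s C w → Ess G s D w ∧ ht C ≤ ht D := by
    intro w
    rcases (Finset.univ.filter (fun C => Ess G s C w)).eq_empty_or_nonempty with h | h
    · refine ⟨(∅, ∅), fun C hC => ?_⟩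
      have : C ∈ Finset.univ.filter (fun C => Ess G s C w) := by simp [hC]
      simp [h] at this
    · obtain ⟨D, hD, hmax⟩ := Finset.exists_max_image _ ht h
      refine ⟨D, fun C hC => ⟨by simpa using hD, hmax C (by simp [hC])⟩⟩
  choose m hm using this
  exact ⟨m, hm⟩

lemma bad_card {G : V → V → Prop} (hG : IsTournament G) {s : ℕ} {m : V → Finset V × Finset V}
    (hm : IsTopCut G s m) (w : V) (I : Finset V)
    (hI : ∀ w' ∈ I, Bad G s w w' ∧ ht (m w) ≤ ht (m w')) : I.card ≤ 2 * cone s := by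
  classical
  have hex : ∀ w', ∃ C, w' ∈ I → Ess G s C w ∧ Ess G s C w' := by
    intro w'
    by_cases h : w' ∈ I
    · obtain ⟨C, hC⟩ := (hI w' h).1.2
      exact ⟨C, fun _ => hC⟩
    · exact ⟨m w, fun h' => absurd h' h⟩
  choose C hC using hex
  rcases I.eq_empty_or_nonempty with rfl | ⟨z, hz⟩
  · simp
  have hD : IsCut G s (m w) := (hm w _ (hC z hz).1).1.1
  have h1 := position_left hG (I.filter (fun w' => w' ∉ (m w).1)) C (m w) hD
    (fun w' hw' => (hC w' (Finset.mem_filter.1 hw').1).2)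
    (fun w' hw' => (hm w _ (hC w' (Finset.mem_filter.1 hw').1).1).2)
    (fun w' hw' => (Finset.mem_filter.1 hw').2)
  have h2 := position_right hG (I.filter (fun w' => w' ∉ (m w).2)) m (m w) hD
    (fun w' hw' => (hm w' _ (hC w' (Finset.mem_filter.1 hw').1).2).1)
    (fun w' hw' => (hI w' (Finset.mem_filter.1 hw').1).2)
    (fun w' hw' => (Finset.mem_filter.1 hw').2)
  have hcov : I ⊆ I.filter (fun w' => w' ∉ (m w).1) ∪ I.filter (fun w' => w' ∉ (m w).2) := by
    intro v hv
    by_cases h : v ∈ (m w).1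
    · have := Finset.disjoint_left.1 hD.1 h
      simp [hv, this]
    · simp [hv, h]
  have h3 := Finset.card_le_card hcov
  have h4 := Finset.card_union_le (I.filter (fun w' => w' ∉ (m w).1))
    (I.filter (fun w' => w' ∉ (m w).2))
  omega

/-- The two-level lemma. -/
lemma two_level {G : V → V → Prop} (hG : IsTournament G) {s : ℕ} {m : V → Finset V × Finset V}
    (hm : IsTopCut G s m) (U : Finset V) (Vs : V → Finset V) (hU : 3 * cone s + 1 ≤ U.card)
    (hV : ∀ u ∈ U, (∀ v ∈ Vs u, G u v) ∧ 3 * cone s + 1 ≤ (Vs u).card) :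
    ∃ u ∈ U, ∃ u' ∈ U, ∃ v ∈ Vs u', G u v ∧ ¬ Bad G s u v := by
  classical
  by_contra hcon
  push Not at hcon
  have hUne : U.Nonempty := Finset.card_pos.1 (by omega)
  obtain ⟨u₁, hu₁, hmin⟩ := Finset.exists_min_image U (fun u => ht (m u)) hUne
  -- all vertices of `U` are essential
  have hess : ∀ u ∈ U, Ess G s (m u) u := by
    intro u hu
    obtain ⟨v, hv⟩ : (Vs u).Nonempty := Finset.card_pos.1 (by have := (hV u hu).2; omega)
    obtain ⟨_, C, hC, _⟩ := hcon u hu u hu v hv ((hV u hu).1 v hv)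
    exact (hm u C hC).1
  have h1 := bad_card hG hm u₁ ((Vs u₁).filter (fun v => ht (m u₁) ≤ ht (m v))) (by
    intro v hv
    rw [Finset.mem_filter] at hv
    exact ⟨hcon u₁ hu₁ u₁ hu₁ v hv.1 ((hV u₁ hu₁).1 v hv.1), hv.2⟩)
  set A := (Vs u₁).filter (fun v => ¬ ht (m u₁) ≤ ht (m v)) with hA
  have h2 : ((Vs u₁).filter (fun v => ht (m u₁) ≤ ht (m v))).card + A.card = (Vs u₁).card :=
    Finset.card_filter_add_card_filter_not _
  have h3 := (hV u₁ hu₁).2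
  have hAess : ∀ v ∈ A, Ess G s (m v) v := by
    intro v hv
    rw [hA, Finset.mem_filter] at hv
    obtain ⟨_, C, _, hC⟩ := hcon u₁ hu₁ u₁ hu₁ v hv.1 ((hV u₁ hu₁).1 v hv.1)
    exact (hm v C hC).1
  obtain ⟨z, hz, hmax⟩ := Finset.exists_max_image A (fun u => ht (m u))
    (Finset.card_pos.1 (by omega))
  have hD := (hAess z hz).1
  have hzu : ht (m z) < ht (m u₁) := by
    have := (Finset.mem_filter.1 hz).2
    omega
  obtain ⟨v, hvA, hvD⟩ : ∃ v ∈ A, v ∈ (m z).1 := by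
    by_contra hno
    push Not at hno
    have := position_left hG A m (m z) hD hAess hmax hno
    omega
  have h4 := position_right hG (U.filter (fun u => u ∉ (m z).2)) m (m z) hD
    (fun u hu => hess u (Finset.mem_filter.1 hu).1)
    (fun u hu => hzu.le.trans (hmin u (Finset.mem_filter.1 hu).1))
    (fun u hu => (Finset.mem_filter.1 hu).2)
  have h5 : (U.filter (fun u => u ∈ (m z).2)).card + (U.filter (fun u => u ∉ (m z).2)).card
      = U.card := Finset.card_filter_add_card_filter_not _
  have hvV := (Finset.mem_filter.1 hvA).1
  have hv2 := (Finset.mem_filter.1 hvA).2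
  have h6 := bad_card hG hm v (U.filter (fun u => u ∈ (m z).2)) (by
    intro u hu
    rw [Finset.mem_filter] at hu
    have hne : v ≠ u := by
      rintro rfl
      exact Finset.disjoint_left.1 hD.1 hvD hu.2
    have hG' : G u v := hG.of_not hne (hD.2.1 v hvD u hu.2)
    refine ⟨(hcon u hu.1 u₁ hu₁ v hvV hG').symm, ?_⟩
    have := hmin u hu.1
    omega)
  omega

open Classical in
/-- Out-neighbourhood. -/
noncomputable def nout (G : V → V → Prop) (x : V) : Finset V := Finset.univ.filter (fun w => G x w)

open Classical in
/-- The vertices in the middle of a path of length two. -/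
noncomputable def mid (G : V → V → Prop) (x b : V) : Finset V :=
  Finset.univ.filter (fun w => G x w ∧ G w b)

lemma mem_nout {G : V → V → Prop} {x w : V} : w ∈ nout G x ↔ G x w := by simp [nout]

lemma mem_mid {G : V → V → Prop} {x b w : V} : w ∈ mid G x b ↔ G x w ∧ G w b := by simp [mid]

/-- A vertex which is robustly reachable from everywhere. -/
def Robust (G : V → V → Prop) (N : ℕ) (b : V) : Prop :=
  ∀ x, x ≠ b → G x b ∨ N ≤ (mid G x b).card ∨
    ∃ U ⊆ nout G x, N ≤ U.card ∧ ∀ u ∈ U, N ≤ (mid G u b).card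

lemma exists_robust {G : V → V → Prop} (hG : IsTournament G) (N : ℕ) (Φ : Finset V)
    (hΦ : ∃ v, v ∉ Φ) (hd : ∀ v, Φ.card + 4 * N ≤ (nout G v).card) :
    ∃ b, b ∉ Φ ∧ Robust G N b := by
  classical
  obtain ⟨b, hb, hmin⟩ := Finset.exists_min_image Φᶜ (fun v => (nout G v \ Φ).card)
    (by obtain ⟨v, hv⟩ := hΦ; exact ⟨v, by simpa using hv⟩)
  have hbΦ : b ∉ Φ := by simpa using hb
  refine ⟨b, hbΦ, fun x hxb => ?_⟩
  by_cases hx : G x b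
  · exact Or.inl hx
  right
  set F := nout G b \ Φ with hF
  -- general fact
  have gen : ∀ u, ¬ G u b → (nout G u \ Φ) \ F ⊆ mid G u b := by
    intro u hu w hw
    simp only [hF, Finset.mem_sdiff, mem_nout] at hw
    rw [mem_mid]
    refine ⟨hw.1.1, ?_⟩
    have hbw : b ≠ w := by
      rintro rfl
      exact hu hw.1.1
    exact hG.of_not hbw (by tauto)
  by_cases hN : N ≤ (mid G x b).card
  · exact Or.inl hN
  right
  set Ex := F.filter (fun u => (mid G u b).card < N) with hEx
  have hExc : Ex.card ≤ 2 * N := by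
    rcases Ex.eq_empty_or_nonempty with h | h
    · simp [h]
    obtain ⟨u, hu, hc⟩ := exists_large_indeg Ex G h (fun a _ b _ hab => by
      by_cases h : G a b
      · exact Or.inl h
      · exact Or.inr (hG.of_not hab h))
    rw [hEx, Finset.mem_filter] at hu
    have huF := hu.1
    rw [hF, Finset.mem_sdiff, mem_nout] at huF
    have h1 := Finset.card_le_card (gen u (hG.asymm huF.1))
    have h2 : F.card ≤ (nout G u \ Φ).card := hmin u (by simpa using huF.2)
    have h3 : ((nout G u \ Φ) \ F).card + ((nout G u \ Φ) ∩ F).card = (nout G u \ Φ).card :=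
      Finset.card_sdiff_add_card_inter _ _
    have h4 : (Ex.filter (fun a => G a u) ∪ ((nout G u \ Φ) ∩ F)).card ≤ F.card := by
      apply Finset.card_le_card
      intro a ha
      rw [Finset.mem_union] at ha
      rcases ha with ha | ha
      · exact (Finset.mem_filter.1 (Finset.mem_filter.1 ha).1).1
      · exact (Finset.mem_inter.1 ha).2
    rw [Finset.card_union_of_disjoint] at h4
    · omega
    · rw [Finset.disjoint_left]
      intro a ha ha'
      have h5 := (Finset.mem_filter.1 ha).2
      simp only [Finset.mem_inter, Finset.mem_sdiff, mem_nout] at ha'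
      exact hG.asymm h5 ha'.1.1
  refine ⟨((nout G x \ Φ) ∩ F) \ Ex, ?_, ?_, ?_⟩
  · intro u hu
    simp only [Finset.mem_sdiff, Finset.mem_inter] at hu
    exact hu.1.1.1
  · have h1 := Finset.card_le_card (gen x hx)
    have h3 : ((nout G x \ Φ) \ F).card + ((nout G x \ Φ) ∩ F).card = (nout G x \ Φ).card :=
      Finset.card_sdiff_add_card_inter _ _
    have h4 := Finset.le_card_sdiff Ex ((nout G x \ Φ) ∩ F)
    have h5 := Finset.le_card_sdiff Φ (nout G x)
    have h6 := hd x
    omega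
  · intro u hu
    by_contra hlt
    rw [Finset.mem_sdiff] at hu
    exact hu.2 (Finset.mem_filter.2 ⟨(Finset.mem_inter.1 hu.1).2, by omega⟩)

lemma exists_robusts {G : V → V → Prop} (hG : IsTournament G) (N : ℕ) (Φ : Finset V) (k : ℕ)
    (hV : Nonempty V) (hd : ∀ v, Φ.card + k + 4 * N + 1 ≤ (nout G v).card) :
    ∃ b : Fin k → V, Function.Injective b ∧ ∀ i, b i ∉ Φ ∧ Robust G N (b i) := by
  classical
  induction k with
  | zero => exact ⟨Fin.elim0, fun i => i.elim0, fun i => i.elim0⟩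
  | succ k ih =>
    obtain ⟨b, hb, hb'⟩ := ih (fun v => by have := hd v; omega)
    have hcard : (Φ ∪ Finset.univ.image b).card ≤ Φ.card + k := by
      refine (Finset.card_union_le _ _).trans ?_
      have : (Finset.univ.image b).card ≤ k := by
        simpa using Finset.card_image_le (s := Finset.univ) (f := b)
      omega
    obtain ⟨c, hc, hc'⟩ := exists_robust hG N (Φ ∪ Finset.univ.image b) (by
      obtain ⟨v⟩ := hV
      by_contra hno
      push Not at hno
      have h1 : nout G v ⊆ Φ ∪ Finset.univ.image b := fun w _ => hno w
      have := Finset.card_le_card h1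
      have := hd v
      omega) (fun v => by have := hd v; omega)
    simp only [Finset.mem_union, Finset.mem_image, Finset.mem_univ, true_and, not_or,
      not_exists] at hc
    refine ⟨Fin.cons c b, ?_, ?_⟩
    · rw [Fin.cons_injective_iff]
      refine ⟨?_, hb⟩
      rintro ⟨i, hi⟩
      exact hc.2 i hi
    · intro i
      refine Fin.cases ?_ (fun j => ?_) i
      · exact ⟨hc.1, hc'⟩
      · exact hb' j

/-- The support of an item. -/
def supp (a : V × V) : Finset V := {a.1, a.2}

/-- An item for the pair `(x, b)`: the interior of a path of length two or three. -/
def Item (G : V → V → Prop) (s : ℕ) (Φ : Finset V) (x b : V) (a : V × V) : Prop :=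
  a.1 ∉ Φ ∧ a.2 ∉ Φ ∧ G x a.1 ∧ G a.2 b ∧ (a.1 = a.2 ∨ (G a.1 a.2 ∧ ¬ Bad G s a.1 a.2))

lemma exists_family {G : V → V → Prop} (hG : IsTournament G) {s : ℕ}
    {m : V → Finset V × Finset V} (hm : IsTopCut G s m) {N : ℕ} (Φ : Finset V) {x b : V}
    (hb : Robust G N b) (hxb : x ≠ b) (hn : ¬ G x b) (n : ℕ)
    (hN : Φ.card + 2 * n + (3 * cone s + 1) ≤ N) :
    ∃ A : Finset (V × V), A.card = n ∧ (∀ a ∈ A, Item G s Φ x b a) ∧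
      ∀ a ∈ A, ∀ a' ∈ A, a ≠ a' → Disjoint (supp a) (supp a') := by
  classical
  induction n with
  | zero => exact ⟨∅, by simp⟩
  | succ n ih =>
    obtain ⟨A, hA, hAI, hAd⟩ := ih (by omega)
    set Z := Φ ∪ A.biUnion supp with hZ
    have hZc : Z.card ≤ Φ.card + 2 * n := by
      refine (Finset.card_union_le _ _).trans ?_
      have : (A.biUnion supp).card ≤ A.card * 2 :=
        Finset.card_biUnion_le_card_mul _ _ _ (fun a _ => Finset.card_le_two)
      omega
    obtain ⟨a, ha1, ha2, ha⟩ : ∃ a : V × V, a.1 ∉ Z ∧ a.2 ∉ Z ∧ Item G s Φ x b a := by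
      rcases hb x hxb with h | h | ⟨U, hU, hUc, hUm⟩
      · exact absurd h hn
      · have h1 := Finset.le_card_sdiff Z (mid G x b)
        obtain ⟨w, hw⟩ : (mid G x b \ Z).Nonempty := Finset.card_pos.1 (by omega)
        rw [Finset.mem_sdiff, mem_mid] at hw
        have hwΦ : w ∉ Φ := fun h => hw.2 (Finset.mem_union_left _ h)
        exact ⟨(w, w), hw.2, hw.2, hwΦ, hwΦ, hw.1.1, hw.1.2, Or.inl rfl⟩
      · have h1 := Finset.le_card_sdiff Z U
        obtain ⟨u, hu, u', hu', v, hv, huv, hbad⟩ := two_level hG hm (U \ Z)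
          (fun u => mid G u b \ Z) (by omega) (by
            intro u hu
            rw [Finset.mem_sdiff] at hu
            refine ⟨fun v hv => (mem_mid.1 (Finset.mem_sdiff.1 hv).1).1, ?_⟩
            have h2 := Finset.le_card_sdiff Z (mid G u b)
            have h3 := hUm u hu.1
            omega)
        rw [Finset.mem_sdiff] at hu hv
        refine ⟨(u, v), hu.2, hv.2, fun h => hu.2 (Finset.mem_union_left _ h),
          fun h => hv.2 (Finset.mem_union_left _ h), mem_nout.1 (hU hu.1), (mem_mid.1 hv.1).2,
          Or.inr ⟨huv, hbad⟩⟩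
    have hdis : ∀ a' ∈ A, Disjoint (supp a) (supp a') := by
      intro a' ha'
      rw [Finset.disjoint_left]
      intro v hv hv'
      have hvZ : v ∈ Z := Finset.mem_union_right _ (Finset.mem_biUnion.2 ⟨a', ha', hv'⟩)
      simp only [supp, Finset.mem_insert, Finset.mem_singleton] at hv
      rcases hv with rfl | rfl
      · exact ha1 hvZ
      · exact ha2 hvZ
    have haA : a ∉ A := by
      intro h
      have := Finset.disjoint_left.1 (hdis a h) (show a.1 ∈ supp a by simp [supp])
      exact this (by simp [supp])
    refine ⟨insert a A, by rw [Finset.card_insert_of_notMem haA, hA], ?_, ?_⟩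
    · intro c hc
      rw [Finset.mem_insert] at hc
      rcases hc with rfl | hc
      · exact ha
      · exact hAI c hc
    · intro c hc c' hc' hne
      rw [Finset.mem_insert] at hc hc'
      rcases hc with rfl | hc <;> rcases hc' with rfl | hc'
      · exact absurd rfl hne
      · exact hdis c' hc'
      · exact (hdis c hc).symm
      · exact hAd c hc c' hc' hne

/-- Selection of pairwise conflict-free representatives. -/
lemma selection {ι α : Type} [DecidableEq ι] [DecidableEq α] [Nonempty α] (R : α → α → Prop)
    (d : ℕ) (J : Finset ι) :
    ∀ A : ι → Finset α, (∀ j ∈ J, ∀ a, ∀ B ⊆ A j, (∀ b ∈ B, R a b) → B.card ≤ d) →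
    (∀ j ∈ J, J.card ^ 2 * d + 1 ≤ (A j).card) →
    ∃ f : ι → α, (∀ i ∈ J, f i ∈ A i) ∧ ∀ i ∈ J, ∀ j ∈ J, i ≠ j → ¬ R (f i) (f j) := by
  classical
  induction J using Finset.induction_on with
  | empty =>
    intro A _ _
    exact ⟨fun _ => Classical.arbitrary α, by simp, by simp⟩
  | insert i₀ J hi₀ ih =>
    intro A hd hc
    rw [Finset.card_insert_of_notMem hi₀] at hc
    set q := J.card with hq
    set n := (q + 1) ^ 2 * d + 1 with hn
    have htrim : ∀ j, ∃ B, j ∈ insert i₀ J → B ⊆ A j ∧ B.card = n := by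
      intro j
      by_cases hj : j ∈ insert i₀ J
      · obtain ⟨B, hB⟩ := Finset.exists_subset_card_eq (hc j hj)
        exact ⟨B, fun _ => hB⟩
      · exact ⟨∅, fun h => absurd h hj⟩
    choose B hB using htrim
    obtain ⟨a, ha, hain⟩ : ∃ a ∈ B i₀,
        ∑ j ∈ J, ((B j).filter (fun b => R b a)).card ≤ q * d := by
      by_contra hno
      push Not at hno
      have h1 : ∑ a ∈ B i₀, (q * d + 1)
          ≤ ∑ a ∈ B i₀, ∑ j ∈ J, ((B j).filter (fun b => R b a)).card :=
        Finset.sum_le_sum fun a ha => hno a ha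
      have h2 : ∑ a ∈ B i₀, ∑ j ∈ J, ((B j).filter (fun b => R b a)).card
          = ∑ j ∈ J, ∑ b ∈ B j, ((B i₀).filter (fun a => R b a)).card := by
        rw [Finset.sum_comm]
        refine Finset.sum_congr rfl fun j _ => ?_
        simp only [Finset.card_filter]
        rw [Finset.sum_comm]
      have h3 : ∑ j ∈ J, ∑ b ∈ B j, ((B i₀).filter (fun a => R b a)).card
          ≤ ∑ j ∈ J, n * d := by
        refine Finset.sum_le_sum fun j hj => ?_
        rw [← (hB j (Finset.mem_insert_of_mem hj)).2, ← smul_eq_mul, ← Finset.sum_const]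
        refine Finset.sum_le_sum fun b _ => ?_
        refine hd i₀ (Finset.mem_insert_self _ _) b _ ?_ ?_
        · exact (Finset.filter_subset _ _).trans (hB i₀ (Finset.mem_insert_self _ _)).1
        · intro c hc
          exact (Finset.mem_filter.1 hc).2
      rw [h2] at h1
      have h4 := h1.trans h3
      simp only [Finset.sum_const, smul_eq_mul, (hB i₀ (Finset.mem_insert_self _ _)).2,
        ← hq] at h4
      have h5 : 0 < n := by omega
      nlinarith
    obtain ⟨f, hf, hf'⟩ := ih (fun j => (B j).filter (fun b => ¬ (R a b ∨ R b a))) (by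
        intro j hj a C hC
        exact hd j (Finset.mem_insert_of_mem hj) a C
          (hC.trans ((Finset.filter_subset _ _).trans (hB j (Finset.mem_insert_of_mem hj)).1)))
      (by
        intro j hj
        have h1 : ((B j).filter (fun b => R a b ∨ R b a)).card
          + ((B j).filter (fun b => ¬ (R a b ∨ R b a))).card = (B j).card :=
          Finset.card_filter_add_card_filter_not _
        rw [(hB j (Finset.mem_insert_of_mem hj)).2] at h1
        have h2 : ((B j).filter (fun b => R a b ∨ R b a)).card ≤ d + q * d := by
          rw [Finset.filter_or]
          refine (Finset.card_union_le _ _).trans (add_le_add ?_ ?_)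
          · refine hd j (Finset.mem_insert_of_mem hj) a _ ?_ ?_
            · exact (Finset.filter_subset _ _).trans (hB j (Finset.mem_insert_of_mem hj)).1
            · intro c hc
              exact (Finset.mem_filter.1 hc).2
          · exact (Finset.single_le_sum (f := fun j => ((B j).filter (fun b => R b a)).card)
              (fun _ _ => Nat.zero_le _) hj).trans hain
        have h3 : n = q ^ 2 * d + q * d + (d + q * d) + 1 := by rw [hn]; ring
        have h4 : 0 ≤ q * d := Nat.zero_le _
        omega)
    refine ⟨Function.update f i₀ a, ?_, ?_⟩
    · intro i hi
      rw [Finset.mem_insert] at hi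
      by_cases h : i = i₀
      · subst h
        simpa using (hB i (Finset.mem_insert_self _ _)).1 ha
      · rw [Function.update_of_ne h]
        have hiJ : i ∈ J := by tauto
        exact (hB i (Finset.mem_insert_of_mem hiJ)).1 (Finset.mem_filter.1 (hf i hiJ)).1
    · intro i hi j hj hij
      rw [Finset.mem_insert] at hi hj
      by_cases h : i = i₀
      · subst h
        have hjJ : j ∈ J := by
          rcases hj with rfl | hj
          · exact absurd rfl hij
          · exact hj
        rw [Function.update_self, Function.update_of_ne hij.symm]
        have := (Finset.mem_filter.1 (hf j hjJ)).2
        tauto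
      · have hiJ : i ∈ J := by tauto
        rw [Function.update_of_ne h]
        by_cases h' : j = i₀
        · subst h'
          rw [Function.update_self]
          have := (Finset.mem_filter.1 (hf i hiJ)).2
          tauto
        · rw [Function.update_of_ne h']
          exact hf' i hiJ j (by tauto) hij

/-- The conflict relation between items. -/
def Conf (G : V → V → Prop) (s : ℕ) (m : V → Finset V × Finset V) (a a' : V × V) : Prop :=
  ∃ α ∈ supp a, ∃ β ∈ supp a', (α = β ∨ Bad G s α β) ∧ ht (m α) ≤ ht (m β)

lemma conf_degree {G : V → V → Prop} (hG : IsTournament G) {s : ℕ}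
    {m : V → Finset V × Finset V} (hm : IsTopCut G s m) (a : V × V) (B : Finset (V × V))
    (hdis : ∀ b ∈ B, ∀ b' ∈ B, b ≠ b' → Disjoint (supp b) (supp b'))
    (hB : ∀ b ∈ B, Conf G s m a b) : B.card ≤ 2 * (2 * cone s + 1) := by
  classical
  set Q := (supp a).biUnion (fun α => insert α
    (Finset.univ.filter (fun β => Bad G s α β ∧ ht (m α) ≤ ht (m β)))) with hQ
  have hQc : Q.card ≤ 2 * (2 * cone s + 1) := by
    refine (Finset.card_biUnion_le_card_mul _ _ (2 * cone s + 1) ?_).trans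
      (Nat.mul_le_mul_right _ Finset.card_le_two)
    intro α _
    refine (Finset.card_insert_le _ _).trans ?_
    have := bad_card hG hm α (Finset.univ.filter (fun β => Bad G s α β ∧ ht (m α) ≤ ht (m β)))
      (fun β hβ => (Finset.mem_filter.1 hβ).2)
    omega
  refine le_trans (Finset.card_le_card_biUnion (f := fun b => supp b ∩ Q) ?_ ?_)
    ((Finset.card_le_card ?_).trans hQc)
  · intro b hb b' hb' hne
    exact (hdis b hb b' hb' hne).mono Finset.inter_subset_left Finset.inter_subset_left
  · intro b hb
    obtain ⟨α, hα, β, hβ, h, h'⟩ := hB b hb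
    refine ⟨β, Finset.mem_inter.2 ⟨hβ, Finset.mem_biUnion.2 ⟨α, hα, ?_⟩⟩⟩
    rw [Finset.mem_insert]
    rcases h with rfl | h
    · exact Or.inl rfl
    · exact Or.inr (Finset.mem_filter.2 ⟨Finset.mem_univ _, h, h'⟩)
  · intro v hv
    obtain ⟨b, _, hb⟩ := Finset.mem_biUnion.1 hv
    exact (Finset.mem_inter.1 hb).2

/-- The number of items needed in each family. -/
def cn (k s : ℕ) : ℕ := (k * k) ^ 2 * (2 * (2 * cone s + 1)) + 1

lemma exists_items {G : V → V → Prop} (hG : IsTournament G) (s : ℕ) (k N : ℕ) [Nonempty V]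
    (Φ : Finset V) (x b : Fin k → V) (hb : ∀ j, Robust G N (b j)) (hxb : ∀ i j, x i ≠ b j)
    (hN : Φ.card + 2 * cn k s + (3 * cone s + 1) ≤ N) :
    ∃ it : Fin k × Fin k → V × V,
      (∀ p, ¬ G (x p.1) (b p.2) → Item G s Φ (x p.1) (b p.2) (it p)) ∧
      ∀ p q, ¬ G (x p.1) (b p.2) → ¬ G (x q.1) (b q.2) → p ≠ q →
        ∀ α ∈ supp (it p), ∀ β ∈ supp (it q), α ≠ β ∧ ¬ Bad G s α β := by
  classical
  obtain ⟨m, hm⟩ := exists_top G s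
  have hfam : ∀ p : Fin k × Fin k, ∃ A : Finset (V × V), ¬ G (x p.1) (b p.2) →
      A.card = cn k s ∧ (∀ a ∈ A, Item G s Φ (x p.1) (b p.2) a) ∧
      ∀ a ∈ A, ∀ a' ∈ A, a ≠ a' → Disjoint (supp a) (supp a') := by
    intro p
    by_cases h : G (x p.1) (b p.2)
    · exact ⟨∅, fun h' => absurd h h'⟩
    · obtain ⟨A, hA⟩ := exists_family hG hm Φ (hb p.2) (hxb p.1 p.2) h (cn k s) hN
      exact ⟨A, fun _ => hA⟩
  choose A hA using hfam
  set J : Finset (Fin k × Fin k) := Finset.univ.filter (fun p => ¬ G (x p.1) (b p.2)) with hJ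
  have hJm : ∀ p, p ∈ J ↔ ¬ G (x p.1) (b p.2) := by intro p; simp [hJ]
  have hJc : J.card ≤ k * k := by
    refine (Finset.card_le_univ J).trans ?_
    simp
  obtain ⟨f, hf, hf'⟩ := selection (Conf G s m) (2 * (2 * cone s + 1)) J A (by
      intro j hj a B hB hBc
      have h := hA j ((hJm j).1 hj)
      exact conf_degree hG hm a B (fun b hb b' hb' => h.2.2 b (hB hb) b' (hB hb')) hBc) (by
      intro j hj
      have h := hA j ((hJm j).1 hj)
      rw [h.1]
      unfold cn
      gcongr)
  refine ⟨f, fun p hp => (hA p hp).2.1 _ (hf p ((hJm p).2 hp)), ?_⟩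
  intro p q hp hq hpq α hα β hβ
  have h1 := hf' p ((hJm p).2 hp) q ((hJm q).2 hq) hpq
  have h2 := hf' q ((hJm q).2 hq) p ((hJm p).2 hp) hpq.symm
  rw [← not_or]
  intro h
  rcases le_total (ht (m α)) (ht (m β)) with hle | hle
  · exact h1 ⟨α, hα, β, hβ, h, hle⟩
  · exact h2 ⟨β, hβ, α, hα, h.imp Eq.symm Bad.symm, hle⟩

lemma chain_stay {G : V → V → Prop} {L R : Finset V} (h : ∀ a ∈ L, ∀ b ∈ R, ¬ G a b) :
    ∀ (p : List V) (a : V), a ∈ L → List.IsChain G (a :: p) → (∀ v ∈ p, v ∈ L ∨ v ∈ R) →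
      ∀ v ∈ a :: p, v ∈ L := by
  intro p
  induction p with
  | nil =>
    intro a ha _ _ v hv
    simp only [List.mem_singleton] at hv
    exact hv ▸ ha
  | cons c p ih =>
    intro a ha hc hp v hv
    rw [List.isChain_cons_cons] at hc
    have hcL : c ∈ L := by
      rcases hp c (by simp) with h' | h'
      · exact h'
      · exact absurd hc.1 (h a ha c h')
    rw [List.mem_cons] at hv
    rcases hv with rfl | hv
    · exact ha
    · exact ih c hcL hc.2 (fun v hv => hp v (by simp [hv])) v hv

/-- A large cut contradicts connectivity. -/
lemma no_cut {G : V → V → Prop} {k : ℕ} (hconn : StronglyKConnected G (2 * k + 1))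
    {L R : Finset V} (hd : Disjoint L R) (h : ∀ a ∈ L, ∀ b ∈ R, ¬ G a b)
    (hc : ((L ∪ R)ᶜ).card ≤ 2 * k) (hL : L.Nonempty) (hR : R.Nonempty) : False := by
  classical
  obtain ⟨a, ha⟩ := hL
  obtain ⟨c, hcR⟩ := hR
  have hac : a ≠ c := by
    rintro rfl
    exact Finset.disjoint_left.1 hd ha hcR
  obtain ⟨p, ⟨_, _, hchain⟩, hhead, hlast, havoid⟩ := hconn.2 (((L ∪ R)ᶜ : Finset V) : Set V)
    (by rw [Set.ncard_coe_finset]; simpa using hc) a c (by simp [ha]) (by simp [hcR]) hac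
  cases p with
  | nil => simp at hhead
  | cons z p =>
    simp only [List.head?_cons, Option.some.injEq] at hhead
    subst hhead
    have := chain_stay h p z ha hchain (by
      intro v hv
      have := havoid v (by simp [hv])
      simp only [Finset.mem_coe, Finset.mem_compl, not_not, Finset.mem_union] at this
      exact this) c (List.mem_of_getLast? hlast)
    exact Finset.disjoint_left.1 hd this hcR

lemma exists_sigma {G : V → V → Prop} {k s : ℕ}
    (hconn : StronglyKConnected G (2 * k + 1)) (X Y B W : Finset V)
    (hX : X.card ≤ k) (hY : k ≤ Y.card) (hB : B.card ≤ k) (hs : W.card + 2 * k ≤ s)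
    (hYX : Disjoint Y X) (hYW : Disjoint Y W)
    (hW : ∀ α ∈ W, ∀ β ∈ W, ¬ Bad G s α β) :
    ∃ σ : V → V, (∀ v w, v ∉ X ∪ W ∪ Y → w ∉ X ∪ W ∪ Y → σ v = σ w → v = w) ∧
      ∀ v, v ∉ X ∪ W ∪ Y → σ v ∉ X ∪ W ∧ σ v ∉ B ∧ (σ v = v ∨ G v (σ v)) := by
  classical
  let ι := {v : V // v ∉ X ∪ W ∪ Y}
  let t : ι → Finset V := fun v => (insert v.1 (nout G v.1) \ (X ∪ W)) \ B
  by_cases hall : ∀ A : Finset ι, A.card ≤ (A.biUnion t).card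
  · obtain ⟨f, hf, hft⟩ := (Finset.all_card_le_biUnion_card_iff_exists_injective t).1 hall
    refine ⟨fun v => if h : v ∉ X ∪ W ∪ Y then f ⟨v, h⟩ else v, ?_, ?_⟩
    · intro v w hv hw h
      simp only [dif_pos hv, dif_pos hw] at h
      have := hf h
      exact congrArg Subtype.val this
    · intro v hv
      simp only [dif_pos hv]
      have := hft ⟨v, hv⟩
      simp only [t, Finset.mem_sdiff, Finset.mem_insert, mem_nout] at this
      exact ⟨this.1.2, this.2, this.1.1⟩
  exfalso
  push Not at hall
  obtain ⟨A', hA'⟩ := hall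
  set A : Finset V := A'.image Subtype.val with hA
  have hAc : A.card = A'.card := Finset.card_image_of_injective _ Subtype.val_injective
  have hAm : ∀ v ∈ A, v ∉ X ∪ W ∪ Y := by
    intro v hv
    obtain ⟨u, _, rfl⟩ := Finset.mem_image.1 hv
    exact u.2
  set C : Finset V := A.biUnion (fun v => insert v (nout G v) \ (X ∪ W)) with hC
  have hCB : (C \ B).card < A.card := by
    rw [hAc]
    refine lt_of_le_of_lt (Finset.card_le_card ?_) hA'
    intro v hv
    rw [Finset.mem_sdiff, hC, Finset.mem_biUnion] at hv
    obtain ⟨⟨u, hu, hv1⟩, hv2⟩ := hv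
    obtain ⟨u', hu', rfl⟩ := Finset.mem_image.1 hu
    exact Finset.mem_biUnion.2 ⟨u', hu', Finset.mem_sdiff.2 ⟨hv1, hv2⟩⟩
  have hAC : A ⊆ C := by
    intro v hv
    refine Finset.mem_biUnion.2 ⟨v, hv, Finset.mem_sdiff.2 ⟨Finset.mem_insert_self _ _, ?_⟩⟩
    have := hAm v hv
    rw [Finset.mem_union, not_or] at this
    exact this.1
  set Z : Finset V := (C ∪ B) \ A with hZ
  have hZc : Z.card + 1 ≤ k := by
    have h1 : Z.card = (C ∪ B).card - A.card :=
      Finset.card_sdiff_of_subset (hAC.trans Finset.subset_union_left)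
    have h2 : (C ∪ B).card ≤ (C \ B).card + B.card := by
      rw [Finset.card_sdiff_add_card]
    have h3 := Finset.card_le_card (hAC.trans (Finset.subset_union_left (s₂ := B)))
    omega
  set R₀ : Finset V := (C ∪ B ∪ (X ∪ W))ᶜ with hR₀
  have hcut₀ : ((A ∪ R₀)ᶜ) ⊆ Z ∪ X ∪ W := by
    intro v hv
    simp only [hR₀, hZ, Finset.mem_compl, Finset.mem_union, Finset.mem_sdiff, not_or,
      not_and, not_not] at hv ⊢
    tauto
  have hcutc : ∀ L R : Finset V, A ⊆ L → R₀ ⊆ R → (L ∪ R)ᶜ ⊆ Z ∪ X ∪ W := by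
    intro L R hL hR
    refine Finset.Subset.trans ?_ hcut₀
    exact Finset.compl_subset_compl.2 (Finset.union_subset_union hL hR)
  have hsmall : (Z ∪ X ∪ W).card ≤ s := by
    have h1 := Finset.card_union_le (Z ∪ X) W
    have h2 := Finset.card_union_le Z X
    omega
  -- choose a maximal cut
  obtain ⟨⟨L, R⟩, hLR, hmax⟩ := Finset.exists_max_image
    (Finset.univ.filter (fun D : Finset V × Finset V => A ⊆ D.1 ∧ R₀ ⊆ D.2 ∧ Disjoint D.1 D.2 ∧
      ∀ a ∈ D.1, ∀ b ∈ D.2, ¬ G a b)) (fun D => D.1.card + D.2.card) ⟨(A, R₀), by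
      simp only [Finset.mem_filter, Finset.mem_univ, true_and, Finset.Subset.refl]
      refine ⟨?_, ?_⟩
      · rw [Finset.disjoint_left]
        intro v hv hv'
        have := hAC hv
        simp only [hR₀, Finset.mem_compl, Finset.mem_union, not_or] at hv'
        tauto
      · intro a ha c hc hG
        simp only [hR₀, Finset.mem_compl, Finset.mem_union, not_or] at hc
        refine hc.1.1 (Finset.mem_biUnion.2 ⟨a, ha, Finset.mem_sdiff.2 ⟨?_, ?_⟩⟩)
        · exact Finset.mem_insert_of_mem (mem_nout.2 hG)
        · rw [Finset.mem_union, not_or]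
          exact hc.2⟩
  simp only [Finset.mem_filter, Finset.mem_univ, true_and] at hLR hmax
  obtain ⟨hAL, hRR, hdis, hno⟩ := hLR
  have hsub := hcutc L R hAL hRR
  have hiscut : IsCut G s (L, R) := ⟨hdis, hno, (Finset.card_le_card hsub).trans hsmall⟩
  have hess : ∀ w, w ∉ L → w ∉ R → Ess G s (L, R) w := by
    intro w hwL hwR
    refine ⟨hiscut, hwL, hwR, ?_, ?_⟩
    · by_contra hcon
      push Not at hcon
      have := hmax (L, insert w R) ⟨hAL, hRR.trans (Finset.subset_insert _ _), by
        rw [Finset.disjoint_insert_right]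
        exact ⟨hwL, hdis⟩, by
        intro a ha c hc
        rw [Finset.mem_insert] at hc
        rcases hc with rfl | hc
        · exact hcon a ha
        · exact hno a ha c hc⟩
      simp only [Finset.card_insert_of_notMem hwR] at this
      omega
    · by_contra hcon
      push Not at hcon
      have := hmax (insert w L, R) ⟨hAL.trans (Finset.subset_insert _ _), hRR, by
        rw [Finset.disjoint_insert_left]
        exact ⟨hwR, hdis⟩, by
        intro a ha c hc
        rw [Finset.mem_insert] at ha
        rcases ha with rfl | ha
        · exact hcon c hc
        · exact hno a ha c hc⟩
      simp only [Finset.card_insert_of_notMem hwL] at this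
      omega
  have hone : ((L ∪ R)ᶜ ∩ W).card ≤ 1 := by
    rw [Finset.card_le_one]
    intro α hα β hβ
    rw [Finset.mem_inter] at hα hβ
    by_contra hne
    have h1 := (mem_sep (C := (L, R))).1 hα.1
    have h2 := (mem_sep (C := (L, R))).1 hβ.1
    exact hW α hα.2 β hβ.2 ⟨hne, (L, R), hess α h1.1 h1.2, hess β h2.1 h2.2⟩
  refine no_cut hconn hdis hno ?_ ?_ ?_
  · have h1 : (L ∪ R)ᶜ ⊆ (Z ∪ X) ∪ ((L ∪ R)ᶜ ∩ W) := by
      intro v hv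
      have := hsub hv
      rw [Finset.mem_union] at this ⊢
      rcases this with h | h
      · exact Or.inl h
      · exact Or.inr (Finset.mem_inter.2 ⟨hv, h⟩)
    have h2 := Finset.card_le_card h1
    have h3 := Finset.card_union_le (Z ∪ X) ((L ∪ R)ᶜ ∩ W)
    have h4 := Finset.card_union_le Z X
    omega
  · have : A.Nonempty := Finset.card_pos.1 (by omega)
    exact this.mono hAL
  · obtain ⟨y, hy, hyZ⟩ : ∃ y ∈ Y, y ∉ Z := by
      by_contra hcon
      push Not at hcon
      have := Finset.card_le_card (show Y ⊆ Z from hcon)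
      omega
    refine ⟨y, hRR ?_⟩
    have h1 : y ∉ A := fun h => hAm y h (Finset.mem_union_right _ hy)
    have h2 := Finset.disjoint_left.1 hYX hy
    have h3 := Finset.disjoint_left.1 hYW hy
    simp only [hR₀, hZ, Finset.mem_compl, Finset.mem_union, Finset.mem_sdiff, not_or,
      not_and, not_not] at hyZ ⊢
    tauto

lemma exists_paths {G : V → V → Prop} (M Y : Finset V) (k : ℕ) (b : Fin k → V)
    (hb : Function.Injective b) (hbM : ∀ j, b j ∉ M)
    (σ : V → V) (hinj : ∀ v w, v ∉ M ∪ Y → w ∉ M ∪ Y → σ v = σ w → v = w)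
    (hσ : ∀ v, v ∉ M ∪ Y → σ v ∉ M ∧ (∀ j, σ v ≠ b j) ∧ (σ v = v ∨ G v (σ v))) :
    ∃ Q : Fin k → List V, (∀ j, IsDipath G (Q j) ∧ (Q j).head? = some (b j) ∧
      (∃ y ∈ Y, (Q j).getLast? = some y) ∧ ∀ v ∈ Q j, v ∉ M) ∧
      ∀ i j, i ≠ j → ∀ v ∈ Q i, v ∉ Q j := by
  classical
  have hM : ∀ j n, (∀ l < n, σ^[l] (b j) ∉ Y) → σ^[n] (b j) ∉ M := by
    intro j n
    induction n with
    | zero => intro _; exact hbM j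
    | succ n ih =>
      intro h
      rw [Function.iterate_succ_apply']
      have h1 := ih (fun l hl => h l (by omega))
      have h2 := h n (by omega)
      exact (hσ _ (by simp [h1, h2])).1
  have key : ∀ n n' i j, (∀ l < n, σ^[l] (b i) ∉ Y) → (∀ l < n', σ^[l] (b j) ∉ Y) →
      σ^[n] (b i) = σ^[n'] (b j) → n = n' ∧ i = j := by
    intro n
    induction n with
    | zero =>
      intro n' i j _ h' he
      cases n' with
      | zero => exact ⟨rfl, hb he⟩
      | succ n' =>
        exfalso
        rw [Function.iterate_succ_apply'] at he
        have h1 := hM j n' (fun l hl => h' l (by omega))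
        have h2 := h' n' (by omega)
        exact (hσ _ (by simp [h1, h2])).2.1 i he.symm
    | succ n ih =>
      intro n' i j h h' he
      have h1 := hM i n (fun l hl => h l (by omega))
      have h2 := h n (by omega)
      have h12 : σ^[n] (b i) ∉ M ∪ Y := by simp [h1, h2]
      rw [Function.iterate_succ_apply'] at he
      cases n' with
      | zero => exact absurd he ((hσ _ h12).2.1 j)
      | succ n' =>
        rw [Function.iterate_succ_apply'] at he
        have h1' := hM j n' (fun l hl => h' l (by omega))
        have h2' := h' n' (by omega)
        obtain ⟨h3, h4⟩ := ih n' i j (fun l hl => h l (by omega)) (fun l hl => h' l (by omega))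
          (hinj _ _ h12 (by simp [h1', h2']) he)
        exact ⟨by omega, h4⟩
  have hterm : ∀ j, ∃ n, σ^[n] (b j) ∈ Y := by
    intro j
    by_contra hcon
    push Not at hcon
    obtain ⟨n, n', hne, he⟩ := Finite.exists_ne_map_eq_of_infinite (fun n : ℕ => σ^[n] (b j))
    exact hne (key n n' j j (fun l _ => hcon l) (fun l _ => hcon l) he).1
  have hlt : ∀ j, ∀ l < Nat.find (hterm j), σ^[l] (b j) ∉ Y := fun j l hl => Nat.find_min _ hl
  refine ⟨fun j => (List.range (Nat.find (hterm j) + 1)).map (fun i => σ^[i] (b j)), ?_, ?_⟩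
  · intro j
    refine ⟨⟨by simp, ?_, ?_⟩, ?_, ⟨_, Nat.find_spec (hterm j), ?_⟩, ?_⟩
    · refine List.Nodup.map_on ?_ List.nodup_range
      intro n hn n' hn' he
      rw [List.mem_range] at hn hn'
      exact (key n n' j j (fun l hl => hlt j l (by omega)) (fun l hl => hlt j l (by omega)) he).1
    · refine List.isChain_iff_getElem.2 ?_
      intro i hi
      simp only [List.length_map, List.length_range] at hi
      simp only [List.getElem_map, List.getElem_range]
      rw [Function.iterate_succ_apply']
      have h1 := hM j i (fun l hl => hlt j l (by omega))
      have h2 := hlt j i (by omega)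
      rcases (hσ (σ^[i] (b j)) (by simp [h1, h2])).2.2 with h | h
      · rw [← Function.iterate_succ_apply' σ] at h
        have := (key (i + 1) i j j (fun l hl => hlt j l (by omega))
          (fun l hl => hlt j l (by omega)) h).1
        omega
      · exact h
    · simp [List.range_succ_eq_map]
    · simp [List.range_succ]
    · intro v hv
      obtain ⟨n, hn, rfl⟩ := List.mem_map.1 hv
      rw [List.mem_range] at hn
      exact hM j n (fun l hl => hlt j l (by omega))
  · intro i j hij v hv hv'
    obtain ⟨n, hn, rfl⟩ := List.mem_map.1 hv
    obtain ⟨n', hn', he⟩ := List.mem_map.1 hv'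
    rw [List.mem_range] at hn hn'
    exact hij (key n n' i j (fun l hl => hlt i l (by omega)) (fun l hl => hlt j l (by omega))
      he.symm).2

lemma exists_mids {G : V → V → Prop} {s : ℕ} {Φ : Finset V} {x b : V} {a : V × V}
    (ha : ¬ G x b → Item G s Φ x b a) {q : List V} (hq : List.IsChain G q)
    (hb : q.head? = some b) :
    ∃ l : List V, (∀ v ∈ l, ¬ G x b ∧ v ∈ supp a) ∧ l.Nodup ∧ List.IsChain G (x :: (l ++ q)) := by
  cases q with
  | nil => simp at hb
  | cons z q =>
    simp only [List.head?_cons, Option.some.injEq] at hb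
    subst hb
    by_cases h : G x z
    · exact ⟨[], by simp, by simp, by simpa using ⟨h, hq⟩⟩
    · obtain ⟨_, _, h1, h2, h3⟩ := ha h
      by_cases h4 : a.1 = a.2
      · refine ⟨[a.1], by simp [h, supp], by simp, ?_⟩
        simp only [List.cons_append, List.nil_append, List.isChain_cons_cons]
        exact ⟨h1, h4 ▸ h2, hq⟩
      · refine ⟨[a.1, a.2], by simp [h, supp], by simp [h4], ?_⟩
        simp only [List.cons_append, List.nil_append, List.isChain_cons_cons]
        refine ⟨h1, ?_, h2, hq⟩
        tauto

/-- The separator size used in the main proof. -/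
def cs (k : ℕ) : ℕ := 2 * (k * k) + 2 * k

/-- The robustness parameter used in the main proof. -/
def cN (k : ℕ) : ℕ := 3 * k + 2 * cn k (cs k) + (3 * cone (cs k) + 1)

lemma linked_aux {G : V → V → Prop} (hG : IsTournament G) (k : ℕ)
    (hconn : StronglyKConnected G (2 * k + 1))
    (hdeg : ∀ v : V, 3 * k + 4 * cN k + 1 ≤ outDeg G v) : KLinked G k := by
  classical
  have hcardV := hconn.1
  refine ⟨by omega, ?_⟩
  intro x y hxy
  have hV : Nonempty V := Fintype.card_pos_iff.1 (by omega)
  have hx : Function.Injective x := fun i j h => Sum.inl_injective (hxy (by simpa using h))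
  have hy : Function.Injective y := fun i j h => Sum.inr_injective (hxy (by simpa using h))
  have hne : ∀ i j, x i ≠ y j := by
    intro i j h
    have := hxy (a₁ := Sum.inl i) (a₂ := Sum.inr j) (by simpa using h)
    simp at this
  have hdeg' : ∀ v, 3 * k + 4 * cN k + 1 ≤ (nout G v).card := by
    intro v
    have h1 := hdeg v
    have h2 : outDeg G v = (nout G v).card := by
      unfold outDeg
      rw [← Set.ncard_coe_finset]
      congr 1
      ext w
      simp [mem_nout]
    omega
  set X : Finset V := Finset.univ.image x with hX
  set Y : Finset V := Finset.univ.image y with hY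
  have hXc : X.card = k := by
    rw [hX, Finset.card_image_of_injective _ hx]
    simp
  have hYc : Y.card = k := by
    rw [hY, Finset.card_image_of_injective _ hy]
    simp
  have hxX : ∀ i, x i ∈ X := fun i => Finset.mem_image_of_mem _ (Finset.mem_univ i)
  have hyY : ∀ i, y i ∈ Y := fun i => Finset.mem_image_of_mem _ (Finset.mem_univ i)
  have hXYc : (X ∪ Y).card ≤ 2 * k := by
    have := Finset.card_union_le X Y
    omega
  obtain ⟨b, hb, hb'⟩ := exists_robusts hG (cN k) (X ∪ Y) k hV (by
    intro v
    have := hdeg' v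
    omega)
  set B : Finset V := Finset.univ.image b with hB
  have hBc : B.card = k := by
    rw [hB, Finset.card_image_of_injective _ hb]
    simp
  have hbB : ∀ i, b i ∈ B := fun i => Finset.mem_image_of_mem _ (Finset.mem_univ i)
  have hxb : ∀ i j, x i ≠ b j := by
    intro i j h
    exact (hb' j).1 (Finset.mem_union_left _ (h ▸ hxX i))
  set Φ : Finset V := X ∪ Y ∪ B with hΦ
  obtain ⟨it, hit, hit'⟩ := exists_items hG (cs k) k (cN k) Φ x b (fun j => (hb' j).2) hxb (by
    have : Φ.card ≤ (X ∪ Y).card + B.card := Finset.card_union_le (X ∪ Y) B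
    unfold cN
    omega)
  set W : Finset V := (Finset.univ.filter (fun p : Fin k × Fin k => ¬ G (x p.1) (b p.2))).biUnion
    (fun p => supp (it p)) with hW
  have memW : ∀ v, v ∈ W ↔ ∃ p : Fin k × Fin k, ¬ G (x p.1) (b p.2) ∧ v ∈ supp (it p) := by
    intro v
    simp [hW]
  have hWc : W.card ≤ 2 * (k * k) := by
    refine (Finset.card_biUnion_le_card_mul _ _ 2 (fun a _ => Finset.card_le_two)).trans ?_
    have : (Finset.univ.filter (fun p : Fin k × Fin k => ¬ G (x p.1) (b p.2))).card ≤ k * k := by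
      refine (Finset.card_le_univ _).trans ?_
      simp
    omega
  have hWΦ : ∀ v ∈ W, v ∉ Φ := by
    intro v hv
    obtain ⟨p, hp, hv⟩ := (memW v).1 hv
    have := hit p hp
    simp only [supp, Finset.mem_insert, Finset.mem_singleton] at hv
    rcases hv with rfl | rfl
    · exact this.1
    · exact this.2.1
  have hWbad : ∀ α ∈ W, ∀ β ∈ W, ¬ Bad G (cs k) α β := by
    intro α hα β hβ hbad
    obtain ⟨p, hp, hα⟩ := (memW α).1 hα
    obtain ⟨q, hq, hβ⟩ := (memW β).1 hβ
    by_cases hpq : p = q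
    · subst hpq
      have h1 := (hit p hp).2.2.2.2
      have h2 := hbad.1
      have h3 := hbad.symm
      simp only [supp, Finset.mem_insert, Finset.mem_singleton] at hα hβ
      rcases hα with rfl | rfl <;> rcases hβ with rfl | rfl <;> tauto
    · exact (hit' p q hp hq hpq α hα β hβ).2 hbad
  have hYX : Disjoint Y X := by
    rw [Finset.disjoint_left]
    intro v hv hv'
    obtain ⟨i, _, rfl⟩ := Finset.mem_image.1 hv
    obtain ⟨j, _, h⟩ := Finset.mem_image.1 hv'
    exact hne j i h
  have hYW : Disjoint Y W := by
    rw [Finset.disjoint_left]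
    intro v hv hv'
    exact hWΦ v hv' (by simp [hΦ, hv])
  obtain ⟨σ, hσ, hσ'⟩ := exists_sigma hconn X Y B W hXc.le hYc.ge hBc.le
    (show W.card + 2 * k ≤ cs k by unfold cs; omega) hYX hYW hWbad
  obtain ⟨Q, hQ, hQd⟩ := exists_paths (G := G) (X ∪ W) Y k b hb (by
      intro j h
      rw [Finset.mem_union] at h
      rcases h with h | h
      · exact (hb' j).1 (Finset.mem_union_left _ h)
      · exact hWΦ _ h (by simp [hΦ, hbB j])) σ hσ (by
      intro v hv
      obtain ⟨h1, h2, h3⟩ := hσ' v hv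
      exact ⟨h1, fun j h => h2 (h ▸ hbB j), h3⟩)
  have hτ : ∀ j, ∃ i, (Q j).getLast? = some (y i) := by
    intro j
    obtain ⟨v, hv, hl⟩ := (hQ j).2.2.1
    obtain ⟨i, _, rfl⟩ := Finset.mem_image.1 hv
    exact ⟨i, hl⟩
  choose τ hτ using hτ
  have hτinj : Function.Injective τ := by
    intro j j' h
    by_contra hjj
    refine hQd j j' hjj (y (τ j)) (List.mem_of_getLast? (hτ j)) ?_
    rw [h]
    exact List.mem_of_getLast? (hτ j')
  have hτsurj : Function.Surjective τ := Finite.surjective_of_injective hτinj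
  choose π hπ using hτsurj
  have hπinj : ∀ i j, i ≠ j → π i ≠ π j := by
    intro i j hij h
    exact hij (by rw [← hπ i, ← hπ j, h])
  have hl : ∀ i, ∃ l : List V, (∀ v ∈ l, ¬ G (x i) (b (π i)) ∧ v ∈ supp (it (i, π i))) ∧
      l.Nodup ∧ List.IsChain G (x i :: (l ++ Q (π i))) := fun i =>
    exists_mids (hit (i, π i)) (hQ (π i)).1.2.2 (hQ (π i)).2.1
  choose l hl using hl
  have hlW : ∀ i, ∀ v ∈ l i, v ∈ W := fun i v hv => (memW v).2 ⟨(i, π i), (hl i).1 v hv⟩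
  have hxl : ∀ i j, x i ∉ l j := fun i j h => hWΦ _ (hlW j _ h) (by simp [hΦ, hxX i])
  have hxQ : ∀ i j, x i ∉ Q j := fun i j h => (hQ j).2.2.2 _ h (Finset.mem_union_left _ (hxX i))
  have hlQ : ∀ i j, ∀ v ∈ l i, v ∉ Q j := fun i j v hv h =>
    (hQ j).2.2.2 _ h (Finset.mem_union_right _ (hlW i v hv))
  refine ⟨fun i => x i :: (l i ++ Q (π i)), ?_, ?_⟩
  · intro i
    refine ⟨⟨by simp, ?_, (hl i).2.2⟩, by simp, ?_⟩
    · rw [List.nodup_cons, List.nodup_append]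
      refine ⟨by simp [hxl, hxQ], (hl i).2.1, (hQ (π i)).1.2.1, ?_⟩
      rintro v hv w hw rfl
      exact hlQ i _ v hv hw
    · have := hτ (π i)
      rw [hπ i] at this
      rw [List.getLast?_cons, List.getLast?_append, this]
      simp
  · intro i j hij v hv hv'
    simp only [List.mem_cons, List.mem_append] at hv hv'
    rcases hv with rfl | hv | hv <;> rcases hv' with hv' | hv' | hv'
    · exact hij (hx hv')
    · exact hxl _ _ hv'
    · exact hxQ _ _ hv'
    · exact hxl j i (hv' ▸ hv)
    · have h1 := (hl i).1 v hv
      have h2 := (hl j).1 v hv'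
      exact (hit' (i, π i) (j, π j) h1.1 h2.1 (by simp [hij]) v h1.2 v h2.2).1 rfl
    · exact hlQ _ _ v hv hv'
    · exact hxQ j _ (hv' ▸ hv)
    · exact hlQ _ _ v hv' hv
    · exact hQd _ _ (hπinj i j hij) v hv hv'

lemma exists_poly : ∃ f : Polynomial ℕ, ∀ k : ℕ, f.eval k = 3 * k + 4 * cN k + 1 := by
  let S : Polynomial ℕ := 2 * (Polynomial.X * Polynomial.X) + 2 * Polynomial.X
  let z : Polynomial ℕ := 2 * (S + S * S) + 1
  let c : Polynomial ℕ := S + S * z + (2 * (2 * S * z) + 1)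
  let n : Polynomial ℕ := (Polynomial.X * Polynomial.X) ^ 2 * (2 * (2 * c + 1)) + 1
  let N : Polynomial ℕ := 3 * Polynomial.X + 2 * n + (3 * c + 1)
  refine ⟨3 * Polynomial.X + 4 * N + 1, fun k => ?_⟩
  simp [S, z, c, n, N, cN, cn, cone, cz, cs]

end LinkedAux

/-- There exists a polynomial `f` such that every `(2k+1)`-strongly-connected tournament with
minimum out-degree at least `f(k)` is `k`-linked. -/
theorem exists_polynomial_linked :
    ∃ f : Polynomial ℕ, ∀ (k : ℕ) (V : Type) [Fintype V] (G : V → V → Prop),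
      IsTournament G → StronglyKConnected G (2 * k + 1) →
      (∀ v : V, f.eval k ≤ outDeg G v) → KLinked G k := by
  classical
  obtain ⟨f, hf⟩ := exists_poly
  refine ⟨f, fun k V _ G hG hconn hdeg => linked_aux hG k hconn ?_⟩
  intro v
  rw [← hf k]
  exact hdeg v
end

section
/- There is an absolute constant C > 0 such that every tournament T that is strongly (2k+1)-connected and has minimum out-degree at least C·k^31 is k-linked. -/
namespace TL

def Wk {U : Type} (E : U → U → Prop) (l : List U) (a b : U) : Prop :=
  l.IsChain E ∧ l.head? = some a ∧ l.getLast? = some b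

lemma Wk.ne_nil {U : Type} {E : U → U → Prop} {l : List U} {a b : U} (h : Wk E l a b) :
    l ≠ [] := by
  rintro rfl
  simpa using h.2.1

lemma wk_single {U : Type} (E : U → U → Prop) (a : U) : Wk E [a] a a := by
  simp [Wk]

lemma wk_cons {U : Type} {E : U → U → Prop} {l : List U} {a b c : U} (h : Wk E l a b)
    (hc : E c a) : Wk E (c :: l) c b := by
  obtain ⟨h1, h2, h3⟩ := h
  cases l with
  | nil => simp at h2
  | cons x l =>
    simp at h2
    subst h2
    refine ⟨?_, by simp, ?_⟩
    · simp [List.isChain_cons_cons, hc, h1]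
    · simpa [List.getLast?_cons_cons] using h3

/-- Glue a walk to `z` with a walk starting at `z`. -/
lemma wk_trans {U : Type} {E : U → U → Prop} {l m : List U} {a z b : U} (h : Wk E l a z)
    (hm : Wk E m z b) : Wk E (l ++ m.tail) a b := by
  obtain ⟨h1, h2, h3⟩ := h
  obtain ⟨m1, m2, m3⟩ := hm
  cases m with
  | nil => simp at m2
  | cons x m =>
    simp at m2
    subst m2
    refine ⟨?_, ?_, ?_⟩
    · rw [List.isChain_append]
      refine ⟨h1, by simpa using m1.tail, ?_⟩
      intro p hp q hq
      simp [h3] at hp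
      subst hp
      cases m with
      | nil => simp at hq
      | cons y m =>
        simp at hq
        subst hq
        simp [List.isChain_cons_cons] at m1
        exact m1.1
    · rw [List.head?_append]; simp [h2]
    · rw [List.getLast?_append]
      cases m with
      | nil => simp at m3 ⊢; rw [h3, m3]
      | cons y m =>
        rw [List.getLast?_cons_cons] at m3
        simp [m3]

lemma wk_append_edge {U : Type} {E : U → U → Prop} {l m : List U} {a z y b : U} (h : Wk E l a z)
    (hm : Wk E m y b) (e : E z y) : Wk E (l ++ m) a b := by
  simpa using wk_trans h (wk_cons hm e)

/-- Prefix of a walk. -/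
lemma wk_take {U : Type} {E : U → U → Prop} {l : List U} {a b z : U} (h : Wk E l a b) (i : ℕ)
    (hi : l[i]? = some z) : Wk E (l.take (i+1)) a z := by
  obtain ⟨h1, h2, h3⟩ := h
  refine ⟨h1.take _, ?_, ?_⟩
  · simp [List.head?_take, h2]
  · rw [List.getLast?_take]; simp [hi]

lemma wk_drop {U : Type} {E : U → U → Prop} {l : List U} {a b z : U} (h : Wk E l a b) (i : ℕ)
    (hi : l[i]? = some z) : Wk E (l.drop i) z b := by
  obtain ⟨h1, h2, h3⟩ := h
  have : i < l.length := by
    by_contra hh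
    rw [List.getElem?_eq_none (by omega)] at hi
    simp at hi
  refine ⟨h1.drop _, ?_, ?_⟩
  · simp [List.head?_drop, hi]
  · rw [List.getLast?_drop]; simp [h3]; omega

lemma wk_edge {U : Type} {E : U → U → Prop} {l : List U} {a b u v : U} (h : Wk E l a b) {i : ℕ}
    (hu : l[i]? = some u) (hv : l[i+1]? = some v) : E u v := by
  have := h.1
  rw [List.isChain_iff_getElem] at this
  rw [List.getElem?_eq_some_iff] at hu hv
  obtain ⟨h1, rfl⟩ := hu
  obtain ⟨h2, rfl⟩ := hv
  exact this i h2

lemma wk_suffix_mem {U : Type} {E : U → U → Prop} {l : List U} {a b z : U} (h : Wk E l a b)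
    (hz : z ∈ l) : ∃ l', Wk E l' z b ∧ l' <:+ l := by
  obtain ⟨i, hi⟩ := List.mem_iff_getElem?.1 hz
  exact ⟨_, wk_drop h i hi, List.drop_suffix _ _⟩

lemma wk_to_path {U : Type} {E : U → U → Prop} : ∀ {l : List U} {a b : U}, Wk E l a b →
    ∃ l', Wk E l' a b ∧ l'.Nodup ∧ l' ⊆ l := by
  intro l
  induction l with
  | nil => intro a b h; exact absurd rfl h.ne_nil
  | cons c l ih =>
    intro a b h
    have hc : c = a := by simpa using h.2.1
    subst hc
    cases l with
    | nil => exact ⟨[c], h, by simp, by simp⟩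
    | cons d l =>
      have h1 := h.1
      rw [List.isChain_cons_cons] at h1
      have hw : Wk E (d :: l) d b := ⟨h1.2, by simp, by
        have := h.2.2
        rwa [List.getLast?_cons_cons] at this⟩
      obtain ⟨p, hp, hn, hs⟩ := ih hw
      by_cases hcp : c ∈ p
      · obtain ⟨q, hq, hqs⟩ := wk_suffix_mem hp hcp
        exact ⟨q, hq, hn.sublist hqs.sublist,
          fun x hx => List.mem_cons_of_mem _ (hs (hqs.subset hx))⟩
      · refine ⟨c :: p, wk_cons hp h1.1, by simp [hcp, hn], ?_⟩
        intro x hx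
        rcases List.mem_cons.1 hx with rfl | hx
        · simp
        · exact List.mem_cons_of_mem _ (hs hx)

lemma wk_mono {U : Type} {E F : U → U → Prop} {l : List U} {a b : U} (h : Wk E l a b)
    (hEF : ∀ u v, u ∈ l → v ∈ l → E u v → F u v) : Wk F l a b := by
  refine ⟨?_, h.2⟩
  have := h.1
  rw [List.isChain_iff_getElem] at this ⊢
  intro i hi
  exact hEF _ _ (List.getElem_mem _) (List.getElem_mem _) (this i hi)

/-- A walk from outside `A` into `A` has an entering edge. -/
lemma wk_enter {U : Type} {E : U → U → Prop} (A : U → Prop) : ∀ {l : List U} {a b : U},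
    Wk E l a b → ¬ A a → A b → ∃ u v, u ∈ l ∧ v ∈ l ∧ E u v ∧ ¬ A u ∧ A v := by
  intro l
  induction l with
  | nil => intro a b h; exact absurd rfl h.ne_nil
  | cons c l ih =>
    intro a b h ha hb
    have hc : c = a := by simpa using h.2.1
    subst hc
    cases l with
    | nil =>
      have : c = b := by simpa using h.2.2
      exact absurd (this ▸ hb) ha
    | cons d l =>
      have h1 := h.1
      rw [List.isChain_cons_cons] at h1
      have hw : Wk E (d :: l) d b := ⟨h1.2, by simp, by
        have := h.2.2
        rwa [List.getLast?_cons_cons] at this⟩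
      by_cases hd : A d
      · exact ⟨c, d, by simp, by simp, h1.1, ha, hd⟩
      · obtain ⟨u, v, hu, hv, h⟩ := ih hw hd hb
        exact ⟨u, v, List.mem_cons_of_mem _ hu, List.mem_cons_of_mem _ hv, h⟩

lemma first_split {U : Type} (H : U → Prop) : ∀ (l : List U), (∃ z ∈ l, H z) →
    ∃ l1 z l2, l = l1 ++ z :: l2 ∧ H z ∧ ∀ v ∈ l1, ¬ H v := by
  intro l
  induction l with
  | nil => simp
  | cons c l ih =>
    rintro ⟨z, hz, hH⟩
    by_cases hc : H c
    · exact ⟨[], c, l, rfl, hc, by simp⟩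
    · have : z ∈ l := by
        rcases List.mem_cons.1 hz with rfl | h
        · exact absurd hH hc
        · exact h
      obtain ⟨l1, z', l2, rfl, h1, h2⟩ := ih ⟨z, this, hH⟩
      refine ⟨c :: l1, z', l2, rfl, h1, ?_⟩
      intro v hv
      rcases List.mem_cons.1 hv with rfl | h
      · exact hc
      · exact h2 v h

end TL


namespace TL

def Sys {U : Type} (E : U → U → Prop) (B Y : Finset U) (P : U → List U) : Prop :=
  (∀ t ∈ Y, ∃ b ∈ B, Wk E (P t) b t) ∧
    ∀ s ∈ Y, ∀ t ∈ Y, s ≠ t → ∀ v ∈ P s, v ∉ P t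

def MinSys {U : Type} (E : U → U → Prop) (B Y : Finset U) (P : U → List U) : Prop :=
  Sys E B Y P ∧ ∀ Q, Sys E B Y Q → ∑ t ∈ Y, (P t).length ≤ ∑ t ∈ Y, (Q t).length

lemma exists_minSys {U : Type} {E : U → U → Prop} {B Y : Finset U} (h : ∃ P, Sys E B Y P) :
    ∃ P, MinSys E B Y P := by
  classical
  have h' : ∃ n, ∃ P, Sys E B Y P ∧ ∑ t ∈ Y, (P t).length = n := by
    obtain ⟨P, hP⟩ := h
    exact ⟨_, P, hP, rfl⟩
  obtain ⟨P, hP, hn⟩ := Nat.find_spec h'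
  refine ⟨P, hP, fun Q hQ => ?_⟩
  rw [hn]
  exact Nat.find_min' h' ⟨Q, hQ, rfl⟩

/-- Replace one path. -/
lemma MinSys.replace {U : Type} [DecidableEq U] {E : U → U → Prop} {B Y : Finset U}
    {P : U → List U} (h : MinSys E B Y P) {t : U} (ht : t ∈ Y) {l : List U} {b : U} (hb : b ∈ B)
    (hl : Wk E l b t) (hd : ∀ s ∈ Y, s ≠ t → ∀ v ∈ P s, v ∉ l) :
    (P t).length ≤ l.length := by
  have hs : Sys E B Y (Function.update P t l) := by
    refine ⟨?_, ?_⟩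
    · intro r hr
      by_cases hrt : r = t
      · subst hrt
        exact ⟨b, hb, by simpa using hl⟩
      · simpa [Function.update_of_ne hrt] using h.1.1 r hr
    · intro r hr q hq hrq v hv
      by_cases hrt : r = t
      · subst hrt
        rw [Function.update_self] at hv
        rw [Function.update_of_ne (Ne.symm hrq)]
        exact fun hv' => hd q hq (Ne.symm hrq) v hv' hv
      · rw [Function.update_of_ne hrt] at hv
        by_cases hqt : q = t
        · subst hqt
          rw [Function.update_self]
          exact hd r hr hrt v hv
        · rw [Function.update_of_ne hqt]
          exact h.1.2 r hr q hq hrq v hv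
  have h2 := h.2 _ hs
  rw [← Finset.add_sum_erase _ _ ht, ← Finset.add_sum_erase Y (fun r => (Function.update P t l r).length) ht] at h2
  have : ∑ r ∈ Y.erase t, (Function.update P t l r).length = ∑ r ∈ Y.erase t, (P r).length := by
    apply Finset.sum_congr rfl
    intro r hr
    rw [Function.update_of_ne (Finset.ne_of_mem_erase hr)]
  rw [this] at h2
  simp at h2
  omega

lemma MinSys.nodup {U : Type} [DecidableEq U] {E : U → U → Prop} {B Y : Finset U}
    {P : U → List U} (h : MinSys E B Y P) {t : U} (ht : t ∈ Y) : (P t).Nodup := by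
  obtain ⟨b, hb, hw⟩ := h.1.1 t ht
  obtain ⟨l, hl, hn, hs⟩ := wk_to_path hw
  have h1 := h.replace ht hb hl (fun s hs' hst v hv hv' => h.1.2 s hs' t ht hst v hv (hs hv'))
  have h2 : l.Subperm (P t) := List.subperm_of_subset hn hs
  exact (h2.perm_of_length_le h1).nodup hn

lemma MinSys.reroute {U : Type} [DecidableEq U] {E : U → U → Prop} {B Y : Finset U}
    {P : U → List U} (h : MinSys E B Y P) {t : U} (ht : t ∈ Y) {l : List U} {b z : U} (hb : b ∈ B)
    (hl : Wk E (l ++ [z]) b z) (hd : ∀ s ∈ Y, ∀ v ∈ P s, v ∉ l) {p : ℕ}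
    (hp : (P t)[p]? = some z) : p ≤ l.length := by
  obtain ⟨c, hc, hw⟩ := h.1.1 t ht
  have h1 := wk_drop hw p hp
  have h2 := wk_trans hl h1
  have hz : z ∈ P t := List.mem_of_getElem? hp
  have hlt : p < (P t).length := by
    by_contra hh
    rw [List.getElem?_eq_none (by omega)] at hp
    simp at hp
  have h3 := h.replace ht hb h2 (by
    intro s hs hst v hv hv'
    have h4 := h.1.2 s hs t ht hst v hv
    simp only [List.mem_append, List.mem_singleton] at hv'
    rcases hv' with (hv' | rfl) | hv'
    · exact hd s hs v hv hv'
    · exact h4 hz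
    · exact h4 (List.mem_of_mem_drop (List.mem_of_mem_tail hv')))
  simp at h3
  omega

lemma MinSys.swap {U : Type} [DecidableEq U] {E : U → U → Prop} {B Y : Finset U}
    {P : U → List U} (h : MinSys E B Y P) {s t : U} (hs : s ∈ Y) (ht : t ∈ Y) (hst : s ≠ t)
    {p q p' q' : ℕ} (hp : p + 4 ≤ p') (hq : q + 4 ≤ q') {a b c d : U}
    (ha : (P s)[p+1]? = some a) (hb : (P t)[q'-1]? = some b) (hab : E a b)
    (hc : (P t)[q+1]? = some c) (hd : (P s)[p'-1]? = some d) (hcd : E c d) : False := by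
  obtain ⟨bs, hbs, hws⟩ := h.1.1 s hs
  obtain ⟨bt, hbt, hwt⟩ := h.1.1 t ht
  have h1 := wk_append_edge (wk_take hws _ ha) (wk_drop hwt _ hb) hab
  have h2 := wk_append_edge (wk_take hwt _ hc) (wk_drop hws _ hd) hcd
  have hns := h.nodup hs
  have hnt := h.nodup ht
  have hls : p' - 1 < (P s).length := by
    by_contra hh
    rw [List.getElem?_eq_none (by omega)] at hd
    simp at hd
  have hlt : q' - 1 < (P t).length := by
    by_contra hh
    rw [List.getElem?_eq_none (by omega)] at hb
    simp at hb
  set lt := (P s).take (p+1+1) ++ (P t).drop (q'-1) with hltd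
  set ls := (P t).take (q+1+1) ++ (P s).drop (p'-1) with hlsd
  have hsub_t : ∀ v ∈ lt, v ∈ P s ∨ v ∈ P t := by
    intro v hv
    rcases List.mem_append.1 hv with hv | hv
    · exact Or.inl (List.mem_of_mem_take hv)
    · exact Or.inr (List.mem_of_mem_drop hv)
  have hsub_s : ∀ v ∈ ls, v ∈ P t ∨ v ∈ P s := by
    intro v hv
    rcases List.mem_append.1 hv with hv | hv
    · exact Or.inl (List.mem_of_mem_take hv)
    · exact Or.inr (List.mem_of_mem_drop hv)
  have hdisj : ∀ v ∈ lt, v ∉ ls := by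
    intro v hv hv'
    have hst' := h.1.2 s hs t ht hst v
    rcases List.mem_append.1 hv with hv | hv <;> rcases List.mem_append.1 hv' with hv' | hv'
    · exact hst' (List.mem_of_mem_take hv) (List.mem_of_mem_take hv')
    · exact List.disjoint_take_drop hns (by omega) hv hv'
    · exact List.disjoint_take_drop hnt (by omega) hv' hv
    · exact hst' (List.mem_of_mem_drop hv') (List.mem_of_mem_drop hv)
  let Q : U → List U := fun r => if r = s then ls else if r = t then lt else P r
  have Qs : Q s = ls := by simp [Q]
  have Qt : Q t = lt := by simp [Q, hst.symm]
  have Qo : ∀ r, r ≠ s → r ≠ t → Q r = P r := by intro r h1 h2; simp [Q, h1, h2]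
  have hQ : Sys E B Y Q := by
    refine ⟨?_, ?_⟩
    · intro r hr
      by_cases hrs : r = s
      · subst hrs; rw [Qs]; exact ⟨bt, hbt, h2⟩
      · by_cases hrt : r = t
        · subst hrt; rw [Qt]; exact ⟨bs, hbs, h1⟩
        · rw [Qo r hrs hrt]; exact h.1.1 r hr
    · have key : ∀ r ∈ Y, r ≠ s → r ≠ t → ∀ v ∈ P r, v ∉ ls ∧ v ∉ lt := by
        intro r hr hrs hrt v hv
        have k1 := h.1.2 r hr s hs hrs v hv
        have k2 := h.1.2 r hr t ht hrt v hv
        exact ⟨fun hh => (hsub_s v hh).elim k2 k1, fun hh => (hsub_t v hh).elim k1 k2⟩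
      intro r hr r' hr' hrr v hv hv'
      by_cases hrs : r = s
      · subst hrs
        rw [Qs] at hv
        by_cases hrt : r' = t
        · subst hrt; rw [Qt] at hv'; exact hdisj v hv' hv
        · rw [Qo r' hrr.symm hrt] at hv'
          exact (key r' hr' hrr.symm hrt v hv').1 hv
      · by_cases hrt : r = t
        · subst hrt
          rw [Qt] at hv
          by_cases hrs' : r' = s
          · subst hrs'; rw [Qs] at hv'; exact hdisj v hv hv'
          · rw [Qo r' hrs' hrr.symm] at hv'
            exact (key r' hr' hrs' hrr.symm v hv').2 hv
        · rw [Qo r hrs hrt] at hv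
          by_cases hrs' : r' = s
          · subst hrs'; rw [Qs] at hv'; exact (key r hr hrs hrt v hv).1 hv'
          · by_cases hrt' : r' = t
            · subst hrt'; rw [Qt] at hv'; exact (key r hr hrs hrt v hv).2 hv'
            · rw [Qo r' hrs' hrt'] at hv'
              exact h.1.2 r hr r' hr' hrr v hv hv'
  have h5 := h.2 Q hQ
  have ht' : t ∈ Y.erase s := Finset.mem_erase.2 ⟨hst.symm, ht⟩
  rw [← Finset.add_sum_erase _ _ hs, ← Finset.add_sum_erase _ _ ht',
    ← Finset.add_sum_erase Y (fun r => (Q r).length) hs,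
    ← Finset.add_sum_erase _ (fun r => (Q r).length) ht'] at h5
  have h6 : ∑ r ∈ (Y.erase s).erase t, (Q r).length = ∑ r ∈ (Y.erase s).erase t, (P r).length := by
    apply Finset.sum_congr rfl
    intro r hr
    simp only [Finset.mem_erase] at hr
    rw [Qo r hr.2.1 hr.1]
  rw [h6, Qs, Qt] at h5
  simp only [hltd, hlsd, List.length_append, List.length_take, List.length_drop] at h5
  omega

/-- in-boundary -/
noncomputable def bd {U : Type} [Fintype U] [DecidableEq U] (E : U → U → Prop) (A : Finset U) : Finset U :=
  by classical exact Finset.univ.filter (fun u => u ∉ A ∧ ∃ v ∈ A, E u v)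

lemma mem_bd {U : Type} [Fintype U] [DecidableEq U] {E : U → U → Prop} {A : Finset U} {u : U} :
    u ∈ bd E A ↔ u ∉ A ∧ ∃ v ∈ A, E u v := by
  simp [bd]

lemma menger {U : Type} [Fintype U] [DecidableEq U] {E : U → U → Prop} {B Y : Finset U}
    (h : ∀ A : Finset U, Disjoint A B → (A ∩ Y).card ≤ (bd E A \ Y).card) :
    ∃ P, Sys E B Y P := by
  classical
  let t : {v // v ∉ B} → Finset U := fun v => Finset.univ.filter (fun u => (u = v.1 ∨ E u v.1) ∧ u ∉ Y)
  have hall : ∀ s : Finset {v // v ∉ B}, s.card ≤ (s.biUnion t).card := by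
    intro s
    let A : Finset U := s.map (Function.Embedding.subtype _)
    have hA : A.card = s.card := Finset.card_map _
    have hAB : Disjoint A B := by
      rw [Finset.disjoint_left]
      intro a ha
      simp only [A, Finset.mem_map] at ha
      obtain ⟨a, _, rfl⟩ := ha
      exact a.2
    have hsub : (A \ Y) ∪ (bd E A \ Y) ⊆ s.biUnion t := by
      intro u hu
      rw [Finset.mem_union, Finset.mem_sdiff, Finset.mem_sdiff, mem_bd] at hu
      rw [Finset.mem_biUnion]
      rcases hu with ⟨hu, huY⟩ | ⟨⟨_, v, hv, huv⟩, huY⟩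
      · simp only [A, Finset.mem_map] at hu
        obtain ⟨a, ha, rfl⟩ := hu
        exact ⟨a, ha, by simp [t]; exact huY⟩
      · simp only [A, Finset.mem_map] at hv
        obtain ⟨a, ha, rfl⟩ := hv
        exact ⟨a, ha, by simp [t]; exact ⟨Or.inr huv, huY⟩⟩
    have hdis : Disjoint (A \ Y) (bd E A \ Y) := by
      rw [Finset.disjoint_left]
      intro a ha ha'
      rw [Finset.mem_sdiff] at ha ha'
      exact (mem_bd.1 ha'.1).1 ha.1
    have h1 := Finset.card_le_card hsub
    rw [Finset.card_union_of_disjoint hdis] at h1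
    have h2 := h A hAB
    have h3 := Finset.card_sdiff_add_card_inter A Y
    omega
  obtain ⟨f, hf, hft⟩ := (Finset.all_card_le_biUnion_card_iff_exists_injective t).1 hall
  have hft' : ∀ v, (f v = v.1 ∨ E (f v) v.1) ∧ f v ∉ Y := by
    intro v
    simpa [t] using hft v
  let g : U → U := fun v => if hv : v ∉ B then f ⟨v, hv⟩ else v
  have hg1 : ∀ v (hv : v ∉ B), g v = f ⟨v, hv⟩ := fun v hv => by simp [g, hv]
  have hcancel : ∀ u v, u ∉ B → v ∉ B → g u = g v → u = v := by
    intro u v hu hv huv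
    rw [hg1 u hu, hg1 v hv] at huv
    exact congrArg Subtype.val (hf huv)
  have hnotY : ∀ v, v ∉ B → g v ∉ Y := fun v hv => by
    rw [hg1 v hv]; exact (hft' _).2
  have sep : ∀ (m n : ℕ) (y z : U), y ∈ Y → z ∈ Y → (∀ i < m, g^[i] y ∉ B) → (∀ i < n, g^[i] z ∉ B) →
      g^[m] y = g^[n] z → m = n ∧ y = z := by
    intro m
    induction m with
    | zero =>
      intro n y z hy hz hm hn he
      cases n with
      | zero => exact ⟨rfl, by simpa using he⟩
      | succ n =>
        rw [Function.iterate_succ_apply'] at he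
        simp at he
        exact absurd hy (he ▸ hnotY _ (hn n (by omega)))
    | succ m ih =>
      intro n y z hy hz hm hn he
      cases n with
      | zero =>
        rw [Function.iterate_succ_apply'] at he
        simp at he
        exact absurd hz (he ▸ hnotY _ (hm m (by omega)))
      | succ n =>
        rw [Function.iterate_succ_apply', Function.iterate_succ_apply'] at he
        have := hcancel _ _ (hm m (by omega)) (hn n (by omega)) he
        obtain ⟨h1, h2⟩ := ih n y z hy hz (fun i hi => hm i (by omega)) (fun i hi => hn i (by omega)) this
        exact ⟨by omega, h2⟩
  have hit : ∀ y ∈ Y, ∃ n, g^[n] y ∈ B := by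
    intro y hy
    by_contra hcon
    push Not at hcon
    have : Function.Injective (fun n : ℕ => g^[n] y) := by
      intro m n hmn
      exact (sep m n y y hy hy (fun i _ => hcon i) (fun i _ => hcon i) hmn).1
    exact not_injective_infinite_finite _ this
  have build : ∀ (n : ℕ) (y : U), (∀ i < n, g^[i] y ∉ B) →
      ∃ l, Wk E l (g^[n] y) y ∧ ∀ v ∈ l, ∃ i ≤ n, v = g^[i] y := by
    intro n
    induction n with
    | zero => intro y _; exact ⟨[y], wk_single E y, by simp⟩
    | succ n ih =>
      intro y hn
      obtain ⟨l, hl, hl'⟩ := ih y (fun i hi => hn i (by omega))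
      have hb := hn n (by omega)
      have h1 := (hft' ⟨_, hb⟩).1
      rw [← hg1 _ hb] at h1
      rw [Function.iterate_succ_apply']
      rcases h1 with h1 | h1
      · refine ⟨l, ?_, fun v hv => ?_⟩
        · rw [h1]; exact hl
        · obtain ⟨i, hi, rfl⟩ := hl' v hv
          exact ⟨i, by omega, rfl⟩
      · refine ⟨_, wk_cons hl h1, fun v hv => ?_⟩
        rcases List.mem_cons.1 hv with rfl | hv
        · exact ⟨n+1, le_rfl, by rw [Function.iterate_succ_apply']⟩
        · obtain ⟨i, hi, rfl⟩ := hl' v hv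
          exact ⟨i, by omega, rfl⟩
  have main : ∀ y : U, ∃ l : List U, y ∈ Y → (∃ b ∈ B, Wk E l b y) ∧
      ∃ n, (∀ i < n, g^[i] y ∉ B) ∧ ∀ v ∈ l, ∃ i ≤ n, v = g^[i] y := by
    intro y
    by_cases hy : y ∈ Y
    · have hh := hit y hy
      obtain ⟨l, hl, hl'⟩ := build (Nat.find hh) y (fun i hi => Nat.find_min hh hi)
      exact ⟨l, fun _ => ⟨⟨_, Nat.find_spec hh, hl⟩, _, fun i hi => Nat.find_min hh hi, hl'⟩⟩
    · exact ⟨[], fun h => absurd h hy⟩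
  choose P hP using main
  refine ⟨P, fun y hy => (hP y hy).1, ?_⟩
  intro s hs r hr hsr v hv hv'
  obtain ⟨n, hn, hn'⟩ := (hP s hs).2
  obtain ⟨m, hm, hm'⟩ := (hP r hr).2
  obtain ⟨i, hi, rfl⟩ := hn' v hv
  obtain ⟨j, hj, he⟩ := hm' _ hv'
  exact hsr (sep i j s r hs hr (fun a ha => hn a (by omega)) (fun a ha => hm a (by omega)) he).2

end TL


namespace TL

/-- `rel` has few pairs in every product. -/
def Few {U : Type} (c : ℕ) (rel : U → U → Prop) : Prop :=
  ∀ (C C' : Finset U) (W : Finset (U × U)),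
    (∀ p ∈ W, p.1 ∈ C ∧ p.2 ∈ C' ∧ rel p.1 p.2) → W.card ≤ c * (C.card + C'.card)

lemma few_or {U : Type} {c d : ℕ} {r s : U → U → Prop} (hr : Few c r) (hs : Few d s) :
    Few (c + d) (fun u v => r u v ∨ s u v) := by
  classical
  intro C C' W hW
  have h1 := hr C C' (W.filter (fun p => r p.1 p.2)) (by
    intro p hp
    rw [Finset.mem_filter] at hp
    exact ⟨(hW p hp.1).1, (hW p hp.1).2.1, hp.2⟩)
  have h2 := hs C C' (W.filter (fun p => ¬ r p.1 p.2)) (by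
    intro p hp
    rw [Finset.mem_filter] at hp
    exact ⟨(hW p hp.1).1, (hW p hp.1).2.1, (hW p hp.1).2.2.resolve_left hp.2⟩)
  have h3 := Finset.card_filter_add_card_filter_not (s := W) (fun p => r p.1 p.2)
  rw [add_mul]
  omega

lemma few_exists {U I : Type} {c : ℕ} {r : I → U → U → Prop} (Y : Finset I)
    (hr : ∀ i ∈ Y, Few c (r i)) : Few (Y.card * c) (fun u v => ∃ i ∈ Y, r i u v) := by
  classical
  intro C C' W hW
  have hsub : W ⊆ Y.biUnion (fun i => W.filter (fun p => r i p.1 p.2)) := by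
    intro p hp
    obtain ⟨i, hi, h⟩ := (hW p hp).2.2
    rw [Finset.mem_biUnion]
    exact ⟨i, hi, Finset.mem_filter.2 ⟨hp, h⟩⟩
  refine (Finset.card_le_card hsub).trans ?_
  rw [mul_assoc]
  apply Finset.card_biUnion_le_card_mul
  intro i hi
  apply hr i hi
  intro p hp
  rw [Finset.mem_filter] at hp
  exact ⟨(hW p hp.1).1, (hW p hp.1).2.1, hp.2⟩

lemma few_functional {U : Type} {r : U → U → Prop} (h : ∀ u v v', r u v → r u v' → v = v') :
    Few 1 r := by
  classical
  intro C C' W hW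
  have : W.card ≤ C.card := by
    apply Finset.card_le_card_of_injOn Prod.fst
    · intro p hp; exact (hW p hp).1
    · rintro ⟨a, b⟩ hp ⟨a', b'⟩ hq he
      simp only at he
      subst he
      have := h _ _ _ (hW _ hp).2.2 (hW _ hq).2.2
      simp only at this
      rw [this]
  omega

lemma few_flip {U : Type} {c : ℕ} {r : U → U → Prop} (h : Few c r) :
    Few c (fun u v => r v u) := by
  classical
  intro C C' W hW
  have := h C' C (W.map (Equiv.prodComm U U).toEmbedding) (by
    intro p hp
    rw [Finset.mem_map] at hp
    obtain ⟨q, hq, rfl⟩ := hp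
    exact ⟨(hW q hq).2.1, (hW q hq).1, (hW q hq).2.2⟩)
  rw [Finset.card_map] at this
  rw [add_comm C.card]
  exact this

lemma few_some {V : Type} {c : ℕ} {r : Option V → Option V → Prop} (h : Few c r) :
    Few c (fun u v => r (some u) (some v)) := by
  classical
  intro C C' W hW
  have := h (C.map Function.Embedding.some) (C'.map Function.Embedding.some)
    (W.map (Function.Embedding.some.prodMap Function.Embedding.some)) (by
    intro p hp
    rw [Finset.mem_map] at hp
    obtain ⟨q, hq, rfl⟩ := hp
    refine ⟨Finset.mem_map_of_mem _ (hW q hq).1, Finset.mem_map_of_mem _ (hW q hq).2.1,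
      (hW q hq).2.2⟩)
  simpa [Finset.card_map] using this

lemma few_chain {U L : Type} (Lab : Finset L) (lab : U → L) (pos : U → ℕ)
    (r : U → U → Prop) (hon : ∀ u v, r u v → lab u ∈ Lab ∧ lab v ∈ Lab)
    (hinj1 : ∀ a a' b b', r a b → r a' b' → lab a = lab a' → pos a = pos a' → a = a')
    (hinj2 : ∀ a a' b b', r a b → r a' b' → lab b = lab b' → pos b = pos b' → b = b')
    (hno : ∀ a a' b b', r a b' → r a' b → lab a = lab a' → lab b = lab b' → pos a < pos a' →
      pos b < pos b' → False) : Few Lab.card r := by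
  classical
  intro C C' W hW
  let mx : U × U → Prop := fun p => ∀ b', (p.1, b') ∈ W → lab b' = lab p.2 → pos b' ≤ pos p.2
  have h3 := Finset.card_filter_add_card_filter_not (s := W) mx
  have h1 : (W.filter mx).card ≤ (C ×ˢ Lab).card := by
    apply Finset.card_le_card_of_injOn (fun p => (p.1, lab p.2))
    · intro p hp
      have hp := (Finset.mem_filter.1 hp).1
      exact Finset.mem_product.2 ⟨(hW p hp).1, (hon _ _ (hW p hp).2.2).2⟩
    · rintro ⟨a, b⟩ hp ⟨a', b'⟩ hq he
      simp only [Prod.mk.injEq] at he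
      obtain ⟨rfl, he⟩ := he
      obtain ⟨hp, hp'⟩ := Finset.mem_filter.1 hp
      obtain ⟨hq, hq'⟩ := Finset.mem_filter.1 hq
      have e1 := hp' b' hq he.symm
      have e2 := hq' b hp he
      simp only at e1 e2
      rw [hinj2 a a b b' (hW _ hp).2.2 (hW _ hq).2.2 he (le_antisymm e2 e1)]
  have h2 : (W.filter (fun p => ¬ mx p)).card ≤ (C' ×ˢ Lab).card := by
    apply Finset.card_le_card_of_injOn (fun p => (p.2, lab p.1))
    · intro p hp
      have hp := (Finset.mem_filter.1 hp).1
      exact Finset.mem_product.2 ⟨(hW p hp).2.1, (hon _ _ (hW p hp).2.2).1⟩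
    · have key : ∀ a a' b, (a, b) ∈ W → (a', b) ∈ W → ¬ mx (a, b) → lab a = lab a' →
          ¬ pos a < pos a' := by
        intro a a' b h1 h2 h3 h4 h5
        simp only [mx] at h3
        push Not at h3
        obtain ⟨b', hb', hl, hp⟩ := h3
        exact hno a a' b b' (hW _ hb').2.2 (hW _ h2).2.2 h4 hl.symm h5 hp
      rintro ⟨a, b⟩ hp ⟨a', b'⟩ hq he
      simp only [Prod.mk.injEq] at he
      obtain ⟨rfl, he⟩ := he
      obtain ⟨hp, hp'⟩ := Finset.mem_filter.1 hp
      obtain ⟨hq, hq'⟩ := Finset.mem_filter.1 hq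
      have e1 := key a a' b hp hq hp' he
      have e2 := key a' a b hq hp hq' he.symm
      rw [hinj1 a a' b b (hW _ hp).2.2 (hW _ hq).2.2 he (by omega)]
  rw [Finset.card_product] at h1 h2
  rw [mul_add, mul_comm Lab.card, mul_comm Lab.card]
  omega

def Bad {U : Type} (E : U → U → Prop) (P : U → List U) (Y : Finset U) (w w' : U) : Prop :=
  ∃ s ∈ Y, ∃ t ∈ Y, s ≠ t ∧ ∃ i j a a2 b b2, (P s)[i]? = some a ∧ (P s)[i+1]? = some w ∧
    (P s)[i+2]? = some a2 ∧ (P t)[j]? = some b ∧ (P t)[j+1]? = some w' ∧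
    (P t)[j+2]? = some b2 ∧ ¬ E b a2 ∧ ¬ E a b2

lemma bad_symm {U : Type} {E : U → U → Prop} {P : U → List U} {Y : Finset U} {w w' : U}
    (h : Bad E P Y w w') : Bad E P Y w' w := by
  obtain ⟨s, hs, t, ht, hst, i, j, a, a2, b, b2, h1, h2, h3, h4, h5, h6, h7, h8⟩ := h
  exact ⟨t, ht, s, hs, hst.symm, j, i, b, b2, a, a2, h4, h5, h6, h1, h2, h3, h8, h7⟩

def Consec {U : Type} (P : U → List U) (Y : Finset U) (w w' : U) : Prop :=
  ∃ s ∈ Y, ∃ i, (P s)[i]? = some w ∧ (P s)[i+1]? = some w'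

lemma getElem?_inj_nodup {U : Type} {l : List U} (h : l.Nodup) {i j : ℕ} {u : U}
    (hi : l[i]? = some u) (hj : l[j]? = some u) : i = j := by
  have hlt : i < l.length := by
    by_contra hh
    rw [List.getElem?_eq_none (by omega)] at hi
    simp at hi
  exact (List.getElem?_inj hlt h).1 (hi.trans hj.symm)

lemma MinSys.uniq {U : Type} [DecidableEq U] {E : U → U → Prop} {B Y : Finset U}
    {P : U → List U} (h : MinSys E B Y P) {s t : U} (hs : s ∈ Y) (ht : t ∈ Y) {i j : ℕ} {u : U}
    (hi : (P s)[i]? = some u) (hj : (P t)[j]? = some u) : s = t ∧ i = j := by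
  have hst : s = t := by
    by_contra hne
    exact h.1.2 s hs t ht hne u (List.mem_of_getElem? hi) (List.mem_of_getElem? hj)
  subst hst
  exact ⟨rfl, getElem?_inj_nodup (h.nodup hs) hi hj⟩

lemma few_consec {U : Type} [DecidableEq U] {E : U → U → Prop} {B Y : Finset U}
    {P : U → List U} (h : MinSys E B Y P) : Few 1 (Consec P Y) := by
  apply few_functional
  rintro u v v' ⟨s, hs, i, h1, h2⟩ ⟨t, ht, j, h3, h4⟩
  obtain ⟨rfl, rfl⟩ := h.uniq hs ht h1 h3
  exact Option.some.inj (h2.symm.trans h4)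

lemma few_bad {U : Type} [DecidableEq U] {E : U → U → Prop} {B Y : Finset U}
    {P : U → List U} (h : MinSys E B Y P)
    (htot : ∀ u v u' v', E u u' → E v v' → u ≠ v → E u v ∨ E v u) :
    Few (Y.card * 4) (Bad E P Y) := by
  classical
  have hex : ∀ w : U, ∃ q : U × ℕ, (∃ t ∈ Y, ∃ i : ℕ, (P t)[i]? = some w) →
      q.1 ∈ Y ∧ (P q.1)[q.2]? = some w := by
    intro w
    by_cases hw : ∃ t ∈ Y, ∃ i : ℕ, (P t)[i]? = some w
    · obtain ⟨t, ht, i, hi⟩ := hw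
      exact ⟨(t, i), fun _ => ⟨ht, hi⟩⟩
    · exact ⟨(w, 0), fun h => absurd h hw⟩
  choose q hq using hex
  have hq' : ∀ w t (i : ℕ), t ∈ Y → (P t)[i]? = some w → (q w).1 = t ∧ (q w).2 = i := by
    intro w t i ht hi
    obtain ⟨h1, h2⟩ := hq w ⟨t, ht, i, hi⟩
    exact h.uniq h1 ht h2 hi
  have hcard : (Y ×ˢ Finset.range 4).card = Y.card * 4 := by simp
  rw [← hcard]
  apply few_chain (Y ×ˢ Finset.range 4) (fun w => ((q w).1, (q w).2 % 4)) (fun w => (q w).2)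
  · rintro u v ⟨s, hs, t, ht, hst, i, j, a, a2, b, b2, h1, h2, h3, h4, h5, h6, h7, h8⟩
    obtain ⟨e1, e2⟩ := hq' u s _ hs h2
    obtain ⟨e3, e4⟩ := hq' v t _ ht h5
    simp only [Finset.mem_product, Finset.mem_range, e1, e3]
    exact ⟨⟨hs, Nat.mod_lt _ (by norm_num)⟩, ht, Nat.mod_lt _ (by norm_num)⟩
  · rintro u u' v v' ⟨s, hs, t, ht, hst, i, j, a, a2, b, b2, h1, h2, h3, h4, h5, h6, h7, h8⟩
      ⟨s', hs', t', ht', hst', i', j', a', a2', b', b2', h1', h2', h3', h4', h5', h6', h7', h8'⟩ hl hp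
    obtain ⟨e1, e2⟩ := hq' u s _ hs h2
    obtain ⟨e3, e4⟩ := hq' u' s' _ hs' h2'
    simp only [Prod.mk.injEq] at hl
    have e5 : s = s' := by rw [← e1, ← e3]; exact hl.1
    subst e5
    have e6 : i + 1 = i' + 1 := by rw [← e2, ← e4]; exact hp
    rw [e6] at h2
    exact Option.some.inj (h2.symm.trans h2')
  · rintro u u' v v' ⟨s, hs, t, ht, hst, i, j, a, a2, b, b2, h1, h2, h3, h4, h5, h6, h7, h8⟩
      ⟨s', hs', t', ht', hst', i', j', a', a2', b', b2', h1', h2', h3', h4', h5', h6', h7', h8'⟩ hl hp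
    obtain ⟨e1, e2⟩ := hq' v t _ ht h5
    obtain ⟨e3, e4⟩ := hq' v' t' _ ht' h5'
    simp only [Prod.mk.injEq] at hl
    have e5 : t = t' := by rw [← e1, ← e3]; exact hl.1
    subst e5
    have e6 : j + 1 = j' + 1 := by rw [← e2, ← e4]; exact hp
    rw [e6] at h5
    exact Option.some.inj (h5.symm.trans h5')
  · rintro u u' v v' ⟨s, hs, t, ht, hst, i, j', a, a2, b', b2', h1, h2, h3, h4, h5, h6, h7, h8⟩
      ⟨s', hs', t', ht', hst', i', j, a', a2', b, b2, h1', h2', h3', h4', h5', h6', h7', h8'⟩ hl hl' hp hp'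
    obtain ⟨e1, e2⟩ := hq' u s _ hs h2
    obtain ⟨e3, e4⟩ := hq' u' s' _ hs' h2'
    obtain ⟨f1, f2⟩ := hq' v' t _ ht h5
    obtain ⟨f3, f4⟩ := hq' v t' _ ht' h5'
    simp only [Prod.mk.injEq] at hl hl'
    have e5 : s = s' := by rw [← e1, ← e3]; exact hl.1
    subst e5
    have e6 : t = t' := by rw [← f1, ← f3]; exact hl'.1.symm
    subst e6
    have g1 : i + 4 ≤ i' := by omega
    have g2 : j + 4 ≤ j' := by omega
    obtain ⟨_, _, ws⟩ := h.1.1 s hs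
    obtain ⟨_, _, wt⟩ := h.1.1 t ht
    have nxt : ∀ (l : List U) (m n : ℕ) (z : U), l[n]? = some z → m < n → ∃ y, l[m]? = some y := by
      intro l m n z hz hmn
      have hlt : n < l.length := by
        by_contra hh
        rw [List.getElem?_eq_none (by omega)] at hz
        simp at hz
      exact ⟨l[m]'(by omega), by simp⟩
    obtain ⟨n1, hn1⟩ := nxt _ (i+2+1) _ _ h2' (by omega)
    obtain ⟨n2, hn2⟩ := nxt _ (j+2+1) _ _ h5 (by omega)
    have x1 : E a2 b' := by
      refine (htot a2 b' _ _ (wk_edge ws h3 hn1) (wk_edge wt h4 h5) ?_).resolve_right h7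
      rintro rfl
      exact hst (h.uniq hs ht h3 h4).1
    have x2 : E b2 a' := by
      refine (htot b2 a' _ _ (wk_edge wt h6' hn2) (wk_edge ws h1' h2') ?_).resolve_right h8'
      rintro rfl
      exact hst (h.uniq hs ht h1' h6').1
    exact h.swap hs ht hst (p := i+1) (p' := i'+1) (q := j+1) (q' := j'+1) (by omega) (by omega)
      h3 (by simpa using h4) x1 h6' (by simpa using h1') x2

lemma greedy {U I : Type} [hU : Nonempty U] [DecidableEq I] {c : ℕ} {r : U → U → Prop} (hr : Few c r)
    (hsymm : ∀ u v, r u v → r v u) (m : ℕ) (J : Finset I) : J.card ≤ m →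
    ∀ (n : ℕ) (C : I → Finset U), 2 * c * m * J.card + 1 ≤ n → (∀ i ∈ J, (C i).card = n) →
    ∃ w : I → U, (∀ i ∈ J, w i ∈ C i) ∧ ∀ i ∈ J, ∀ j ∈ J, i ≠ j → ¬ r (w i) (w j) := by
  classical
  induction J using Finset.induction_on with
  | empty =>
    intro hJ n C hn hC
    obtain ⟨u⟩ := hU
    exact ⟨fun _ => u, by simp, by simp⟩
  | insert i0 J hi0 ih =>
    intro hJ n C hn hC
    rw [Finset.card_insert_of_notMem hi0] at hJ hn
    have hC0 := hC i0 (Finset.mem_insert_self _ _)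
    have hCJ : ∀ j ∈ J, (C j).card = n := fun j hj => hC j (Finset.mem_insert_of_mem hj)
    have hsum : ∑ w ∈ C i0, ∑ j ∈ J, ((C j).filter (fun u => r w u)).card ≤ ∑ w ∈ C i0, 2 * c * m := by
      rw [Finset.sum_comm]
      have : ∀ j ∈ J, ∑ w ∈ C i0, ((C j).filter (fun u => r w u)).card ≤ c * (n + n) := by
        intro j hj
        rw [← Finset.card_sigma]
        have := hr (C i0) (C j) (((C i0) ×ˢ (C j)).filter (fun p => r p.1 p.2)) (by
          intro p hp
          rw [Finset.mem_filter, Finset.mem_product] at hp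
          exact ⟨hp.1.1, hp.1.2, hp.2⟩)
        rw [hC0, hCJ j hj] at this
        refine le_trans (le_of_eq ?_) this
        rw [Finset.card_sigma, Finset.card_filter, Finset.sum_product]
        simp only [Finset.card_filter]
      refine (Finset.sum_le_sum this).trans ?_
      simp only [Finset.sum_const, smul_eq_mul, hC0]
      have : J.card ≤ m := by omega
      calc J.card * (c * (n + n)) ≤ m * (c * (n + n)) := Nat.mul_le_mul_right _ this
        _ = n * (2 * c * m) := by ring
    have hne : (C i0).Nonempty := by
      rw [← Finset.card_pos, hC0]; omega
    obtain ⟨w0, hw0, hle⟩ := Finset.exists_le_of_sum_le hne hsum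
    have hD : ∀ j, ∃ D : Finset U, j ∈ J → D ⊆ (C j).filter (fun u => ¬ r w0 u) ∧ D.card = n - 2 * c * m := by
      intro j
      by_cases hj : j ∈ J
      · have h1 : ((C j).filter (fun u => r w0 u)).card ≤ 2 * c * m :=
          (Finset.single_le_sum (f := fun j => ((C j).filter (fun u => r w0 u)).card)
            (fun _ _ => Nat.zero_le _) hj).trans hle
        have h2 := Finset.card_filter_add_card_filter_not (s := C j) (fun u => r w0 u)
        rw [hCJ j hj] at h2
        obtain ⟨D, hD, hD'⟩ := Finset.exists_subset_card_eq (s := (C j).filter (fun u => ¬ r w0 u))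
          (n := n - 2 * c * m) (by omega)
        exact ⟨D, fun _ => ⟨hD, hD'⟩⟩
      · exact ⟨∅, fun h => absurd h hj⟩
    choose D hD using hD
    have hmul : 2 * c * m * (J.card + 1) = 2 * c * m * J.card + 2 * c * m := by ring
    obtain ⟨w, hw, hw'⟩ := ih (by omega) (n - 2 * c * m) D (by omega) (fun j hj => (hD j hj).2)
    have hwD : ∀ j ∈ J, w j ∈ C j ∧ ¬ r w0 (w j) := fun j hj =>
      Finset.mem_filter.1 ((hD j hj).1 (hw j hj))
    refine ⟨Function.update w i0 w0, ?_, ?_⟩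
    · intro j hj
      rcases Finset.mem_insert.1 hj with rfl | hj
      · simpa using hw0
      · have : j ≠ i0 := fun h => hi0 (h ▸ hj)
        rw [Function.update_of_ne this]
        exact (hwD j hj).1
    · intro i hi j hj hij
      rcases Finset.mem_insert.1 hi with rfl | hi
      · have hj : j ∈ J := (Finset.mem_insert.1 hj).resolve_left hij.symm
        rw [Function.update_self, Function.update_of_ne hij.symm]
        exact (hwD j hj).2
      · have hii : i ≠ i0 := fun h => hi0 (h ▸ hi)
        rcases Finset.mem_insert.1 hj with hji | hj
        · rw [hji, Function.update_self, Function.update_of_ne hii]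
          exact fun h => (hwD i hi).2 (hsymm _ _ h)
        · have hjj : j ≠ i0 := fun h => hi0 (h ▸ hj)
          rw [Function.update_of_ne hii, Function.update_of_ne hjj]
          exact hw' i hi j hj hij

end TL


namespace TL

/-- Auxiliary digraph with a twin `none` of the sink `s`. -/
def Es {V : Type} (G : V → V → Prop) (X : Finset V) (s : V) : Option V → Option V → Prop
  | some u, some v => G u v ∧ u ∉ X ∧ v ∉ X
  | some u, none => G u s ∧ u ∉ X
  | none, _ => False

def ConnP {V : Type} (G : V → V → Prop) (k : ℕ) [DecidableEq V] : Prop :=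
  ∀ (R S : Finset V), S.card ≤ 2 * k → ∀ x y, x ∉ R → x ∉ S → y ∈ R → y ∉ S →
    ∃ u v, G u v ∧ u ∉ S ∧ u ∉ R ∧ v ∈ R ∧ v ∉ S

lemma twin_sys {V : Type} [Fintype V] [DecidableEq V] {G : V → V → Prop} {k : ℕ}
    (hconn : ConnP G k) {X Y B : Finset V} (hX : X.card = k) (hY : Y.card = k)
    (hXY : Disjoint X Y) (hBY : Disjoint B Y) (hB : 2 * k + 1 ≤ B.card) {s : V} (hs : s ∈ Y) :
    ∃ P, Sys (Es G X s) (B.map Function.Embedding.some) (Finset.insertNone Y) P := by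
  classical
  apply menger
  intro A hA
  by_contra hlt
  push Not at hlt
  have hpick : ∀ S : Finset V, S.card ≤ 2 * k → ∃ b ∈ B, b ∉ S := by
    intro S hS
    by_contra hcon
    push Not at hcon
    have := Finset.card_le_card (show B ⊆ S from hcon)
    omega
  have hBA : ∀ b ∈ B, some b ∉ A := by
    intro b hb hbA
    exact Finset.disjoint_left.1 hA hbA (Finset.mem_map_of_mem _ hb)
  by_cases hy : ∃ y ∈ Y, some y ∈ A
  · obtain ⟨y, hy, hyA⟩ := hy
    set T := (bd (Es G X s) A \ Finset.insertNone Y) ∪ (Finset.insertNone Y \ A) with hT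
    have hTc : T.card ≤ k := by
      refine (Finset.card_union_le _ _).trans ?_
      have h2 := Finset.card_sdiff_add_card_inter (Finset.insertNone Y) A
      rw [Finset.card_insertNone, hY, Finset.inter_comm] at h2
      omega
    have hS : (X ∪ Finset.eraseNone T).card ≤ 2 * k := by
      have h1 := Finset.card_union_le X (Finset.eraseNone T)
      have h2 := Finset.card_eraseNone_le (s := T)
      omega
    obtain ⟨b, hb, hbS⟩ := hpick _ hS
    obtain ⟨u, v, huv, hu1, hu2, hv1, hv2⟩ := hconn (Finset.eraseNone A) _ hS b y
      (by rw [Finset.mem_eraseNone]; exact hBA b hb) hbS (by rw [Finset.mem_eraseNone]; exact hyA)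
      (by
        rw [Finset.mem_union, Finset.mem_eraseNone, hT, Finset.mem_union, Finset.mem_sdiff,
          Finset.mem_sdiff, mem_bd]
        rintro (h | h | h)
        · exact Finset.disjoint_left.1 hXY h hy
        · exact h.1.1 hyA
        · exact h.2 hyA)
    rw [Finset.mem_eraseNone] at hu2 hv1
    rw [Finset.mem_union, Finset.mem_eraseNone, hT, Finset.mem_union, Finset.mem_sdiff,
          Finset.mem_sdiff] at hu1 hv2
    push Not at hu1 hv2
    have hub : some u ∈ bd (Es G X s) A := mem_bd.2 ⟨hu2, some v, hv1, huv, hu1.1, hv2.1⟩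
    exact hu2 (hu1.2.2 (hu1.2.1 hub))
  · push Not at hy
    have hnone : none ∈ A ∧ (A ∩ Finset.insertNone Y).card ≤ 1 := by
      have hsub : A ∩ Finset.insertNone Y ⊆ {none} := by
        intro o ho
        rw [Finset.mem_inter] at ho
        cases o with
        | none => simp
        | some y => exact absurd ho.1 (hy y (by simpa using ho.2))
      refine ⟨?_, by simpa using Finset.card_le_card hsub⟩
      have hpos : 0 < (A ∩ Finset.insertNone Y).card := by omega
      obtain ⟨o, ho⟩ := Finset.card_pos.1 hpos
      have := hsub ho
      rw [Finset.mem_singleton] at this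
      subst this
      exact (Finset.mem_inter.1 ho).1
    have hb0 : bd (Es G X s) A \ Finset.insertNone Y = ∅ := by
      rw [← Finset.card_eq_zero]; omega
    have hS : (X ∪ Y.erase s).card ≤ 2 * k := by
      have h1 := Finset.card_union_le X (Y.erase s)
      have h2 := Finset.card_erase_le (s := Y) (a := s)
      omega
    obtain ⟨b, hb, hbS⟩ := hpick _ hS
    obtain ⟨u, v, huv, hu1, hu2, hv1, hv2⟩ := hconn (insert s (Finset.eraseNone A)) _ hS b s
      (by
        rw [Finset.mem_insert, Finset.mem_eraseNone]
        rintro (rfl | h)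
        · exact Finset.disjoint_left.1 hBY hb hs
        · exact hBA b hb h) hbS (by simp)
      (by
        rw [Finset.mem_union]
        rintro (h | h)
        · exact Finset.disjoint_left.1 hXY h hs
        · simp at h)
    rw [Finset.mem_insert, Finset.mem_eraseNone] at hu2 hv1
    rw [Finset.mem_union, Finset.mem_erase] at hu1 hv2
    push Not at hu1 hu2 hv2
    have hub : some u ∈ bd (Es G X s) A \ Finset.insertNone Y := by
      rw [Finset.mem_sdiff, mem_bd]
      refine ⟨⟨hu2.2, ?_⟩, ?_⟩
      · rcases hv1 with rfl | hv1
        · exact ⟨none, hnone.1, huv, hu1.1⟩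
        · exact ⟨some v, hv1, huv, hu1.1, hv2.1⟩
      · simp
        exact hu1.2 hu2.1
    rw [hb0] at hub
    simp at hub

def EW {V : Type} (G : V → V → Prop) (X W : Finset V) (u v : V) : Prop :=
  G u v ∧ u ∉ X ∧ v ∉ X ∧ u ∉ W ∧ v ∉ W

lemma last_exit {U : Type} {E : U → U → Prop} (L : U → Prop) {l : List U} {a b : U}
    (h : Wk E l a b) (ha : L a) (hb : ¬ L b) :
    ∃ i u v, l[i]? = some u ∧ l[i+1]? = some v ∧ L u ∧ ∀ j z, i < j → l[j]? = some z → ¬ L z := by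
  classical
  let Q : ℕ → Prop := fun i => ∃ u, l[i]? = some u ∧ L u
  have h0 : Q 0 := ⟨a, by rw [← List.head?_eq_getElem?]; exact h.2.1, ha⟩
  have hi := Nat.findGreatest_spec (P := Q) (Nat.zero_le l.length) h0
  obtain ⟨u, hu, hL⟩ := hi
  set i := Nat.findGreatest Q l.length with hidef
  have hlt : i < l.length := by
    by_contra hh
    rw [List.getElem?_eq_none (by omega)] at hu
    simp at hu
  have hlast := h.2.2
  rw [List.getLast?_eq_getElem?] at hlast
  have hne : i + 1 < l.length := by
    by_contra hh
    have : i = l.length - 1 := by omega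
    rw [← this, hu] at hlast
    exact hb (Option.some.inj hlast ▸ hL)
  refine ⟨i, u, l[i+1], hu, by simp, hL, ?_⟩
  intro j z hij hz hLz
  have hjl : j < l.length := by
    by_contra hh
    rw [List.getElem?_eq_none (by omega)] at hz
    simp at hz
  have := Nat.le_findGreatest (P := Q) hjl.le ⟨z, hz, hLz⟩
  omega

lemma w_lemma {V : Type} [Fintype V] [DecidableEq V] {G : V → V → Prop}
    {X Y B W : Finset V} (hXY : Disjoint X Y) (hWY : Disjoint W Y) (hWB : Disjoint W B)
    (P : V → Option V → List (Option V))
    (hP : ∀ s ∈ Y, MinSys (Es G X s) (B.map Function.Embedding.some) (Finset.insertNone Y) (P s))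
    (hbad : ∀ s ∈ Y, ∀ w ∈ W, ∀ w' ∈ W, w ≠ w' →
      ¬ Bad (Es G X s) (P s) (Finset.insertNone Y) (some w) (some w'))
    (hcon : ∀ s ∈ Y, ∀ w ∈ W, ∀ w' ∈ W, w ≠ w' →
      ¬ Consec (P s) (Finset.insertNone Y) (some w) (some w')) :
    ∃ Q, Sys (EW G X W) B Y Q := by
  classical
  apply menger
  intro A hA
  by_contra hlt
  push Not at hlt
  have hpos : 0 < (A ∩ Y).card := by omega
  obtain ⟨s, hs⟩ := Finset.card_pos.1 hpos
  obtain ⟨hsA, hsY⟩ := Finset.mem_inter.1 hs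
  have hM := hP s hsY
  set S := bd (EW G X W) A with hSdef
  set p := P s with hp
  set Yp := Finset.insertNone Y with hYp
  set T := Finset.insertNone (A ∩ Y) with hT
  have hTY : T ⊆ Yp := by
    intro o ho
    cases o with
    | none => simp [hYp]
    | some y =>
      simp [hT] at ho
      simp [hYp, ho.2]
  have hend : ∀ t ∈ Yp, t ∈ p t := by
    intro t ht
    obtain ⟨b, _, hw⟩ := hM.1.1 t ht
    exact List.mem_of_getLast? hw.2.2
  let Hit : Option V → Prop := fun t => ∃ v, some v ∈ p t ∧ v ∈ S
  have hHit : (T.filter Hit).card ≤ (S \ Y).card := by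
    have hex : ∀ t : Option V, ∃ v : V, t ∈ T.filter Hit → some v ∈ p t ∧ v ∈ S := by
      intro t
      by_cases ht : t ∈ T.filter Hit
      · obtain ⟨v, hv⟩ := (Finset.mem_filter.1 ht).2
        exact ⟨v, fun _ => hv⟩
      · exact ⟨s, fun h => absurd h ht⟩
    choose f hf using hex
    apply Finset.card_le_card_of_injOn f
    · intro t ht
      obtain ⟨h1, h2⟩ := hf t ht
      have htT := (Finset.mem_filter.1 ht).1
      rw [Finset.mem_coe, Finset.mem_sdiff]
      refine ⟨h2, fun hY => ?_⟩
      have h3 : some (f t) ∈ Yp := by simp [hYp, hY]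
      have h4 : t = some (f t) := by
        by_contra hne
        exact hM.1.2 t (hTY htT) _ h3 hne _ h1 (hend _ h3)
      rw [h4] at htT
      simp [hT] at htT
      exact (mem_bd.1 h2).1 htT.1
    · intro t ht t' ht' he
      by_contra hne
      have h1 := (hf t ht).1
      rw [he] at h1
      exact hM.1.2 t (hTY (Finset.mem_filter.1 ht).1) t' (hTY (Finset.mem_filter.1 ht').1) hne _ h1
        (hf t' ht').1
  have hcard : 1 < (T.filter (fun t => ¬ Hit t)).card := by
    have h1 := Finset.card_filter_add_card_filter_not (s := T) Hit
    have h2 : T.card = (A ∩ Y).card + 1 := by rw [hT, Finset.card_insertNone]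
    omega
  obtain ⟨t1, ht1, t2, ht2, hne⟩ := Finset.one_lt_card.1 hcard
  let L : Option V → Prop := fun o => ∃ u, o = some u ∧ u ∉ A ∧ u ∉ S ∧ u ∉ W
  let R : Option V → Prop := fun o => o = none ∨ ∃ u, o = some u ∧ u ∈ A ∧ u ∉ W
  have hsW : s ∉ W := fun h => Finset.disjoint_left.1 hWY h hsY
  have noLR : ∀ a c, L a → R c → ¬ Es G X s a c := by
    rintro a c ⟨u, rfl, h1, h2, h3⟩ (rfl | ⟨v, rfl, h4, h5⟩) hE
    · obtain ⟨e1, e2⟩ := hE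
      refine h2 (mem_bd.2 ⟨h1, s, hsA, e1, e2, ?_, h3, hsW⟩)
      exact fun h => Finset.disjoint_left.1 hXY h hsY
    · obtain ⟨e1, e2, e3⟩ := hE
      exact h2 (mem_bd.2 ⟨h1, v, h4, e1, e2, e3, h3, h5⟩)
  have main : ∀ t ∈ T.filter (fun t => ¬ Hit t), ∃ i a w a2, (p t)[i]? = some a ∧
      (p t)[i+1]? = some (some w) ∧ (p t)[i+2]? = some a2 ∧ L a ∧ w ∈ W ∧ R a2 := by
    intro t ht
    obtain ⟨htT, htH⟩ := Finset.mem_filter.1 ht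
    have hnS : ∀ v, some v ∈ p t → v ∉ S := fun v hv hvS => htH ⟨v, hv, hvS⟩
    obtain ⟨b, hb, hw⟩ := hM.1.1 t (hTY htT)
    have htR : R t := by
      cases t with
      | none => exact Or.inl rfl
      | some y =>
        simp [hT] at htT
        exact Or.inr ⟨y, rfl, htT.1, fun h => Finset.disjoint_left.1 hWY h htT.2⟩
    have hRL : ∀ o, R o → ¬ L o := by
      rintro o (rfl | ⟨u, rfl, h1, h2⟩) ⟨v, hv, h3, _⟩
      · simp at hv
      · rw [← Option.some.inj hv] at h3; exact h3 h1
    have hbL : L b := by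
      obtain ⟨b, hb', rfl⟩ := Finset.mem_map.1 hb
      refine ⟨b, rfl, fun h => Finset.disjoint_left.1 hA h hb', hnS b (List.mem_of_head? hw.2.1),
        fun h => Finset.disjoint_left.1 hWB h hb'⟩
    obtain ⟨i, u, v, hu, hv, hLu, hall⟩ := last_exit L hw hbL (hRL _ htR)
    have htri : ∀ o ∈ p t, ¬ L o → R o ∨ ∃ w ∈ W, o = some w := by
      intro o ho hL
      cases o with
      | none => exact Or.inl (Or.inl rfl)
      | some z =>
        by_cases hzW : z ∈ W
        · exact Or.inr ⟨z, hzW, rfl⟩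
        · by_cases hzA : z ∈ A
          · exact Or.inl (Or.inr ⟨z, rfl, hzA, hzW⟩)
          · exact absurd ⟨z, rfl, hzA, hnS z ho, hzW⟩ hL
    have hv' := htri v (List.mem_of_getElem? hv) (hall (i+1) v (by omega) hv)
    obtain ⟨w, hwW, rfl⟩ := hv'.resolve_left (fun h => noLR _ _ hLu h (wk_edge hw hu hv))
    have hlast := hw.2.2
    rw [List.getLast?_eq_getElem?] at hlast
    have hlt1 : i + 1 < (p t).length := by
      by_contra hh
      rw [List.getElem?_eq_none (by omega)] at hv
      simp at hv
    have hlt2 : i + 2 < (p t).length := by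
      by_contra hh
      have : i + 1 = (p t).length - 1 := by omega
      rw [← this, hv] at hlast
      have e := Option.some.inj hlast
      rw [← e] at htR
      rcases htR with h | ⟨u, h, h1, h2⟩
      · simp at h
      · rw [← Option.some.inj h] at h2; exact h2 hwW
    have hz : (p t)[i+2]? = some ((p t)[i+2]) := by simp
    refine ⟨i, u, w, (p t)[i+2], hu, hv, hz, hLu, hwW, ?_⟩
    rcases htri _ (List.mem_of_getElem? hz) (hall (i+2) _ (by omega) hz) with h | ⟨w', hw', h⟩
    · exact h
    · exfalso
      rw [h] at hz
      by_cases hww : w = w'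
      · subst hww
        have := (hM.uniq (hTY htT) (hTY htT) hv hz).2
        omega
      · exact hcon s hsY w hwW w' hw' hww ⟨t, hTY htT, i+1, hv, hz⟩
  obtain ⟨i, a, w, a2, h1, h2, h3, h4, h5, h6⟩ := main t1 ht1
  obtain ⟨j, b, w', b2, h1', h2', h3', h4', h5', h6'⟩ := main t2 ht2
  have hT1 := hTY (Finset.mem_filter.1 ht1).1
  have hT2 := hTY (Finset.mem_filter.1 ht2).1
  have hww : w ≠ w' := by
    rintro rfl
    exact hne (hM.uniq hT1 hT2 h2 h2').1
  exact hbad s hsY w h5 w' h5' hww ⟨t1, hT1, t2, hT2, hne, i, j, a, a2, b, b2, h1, h2, h3, h1', h2', h3',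
    noLR _ _ h4' h6, noLR _ _ h4 h6'⟩

lemma exists_W {V : Type} [Fintype V] [DecidableEq V] {G : V → V → Prop} {k : ℕ}
    (htot : ∀ u v, u ≠ v → G u v ∨ G v u)
    (hconn : ConnP G k) {X Y B : Finset V} (hX : X.card = k) (hY : Y.card = k)
    (hXY : Disjoint X Y) (hBY : Disjoint B Y) (hB : 2 * k + 1 ≤ B.card)
    (n : ℕ) (hn : 2 * (1 + k * ((k + 1) * 4 + (1 + 1))) * k * k + 1 ≤ n)
    (C : Fin k → Finset V) (hC : ∀ i, (C i).card = n) (hCY : ∀ i, Disjoint (C i) Y)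
    (hCB : ∀ i, Disjoint (C i) B) :
    ∃ w : Fin k → V, Function.Injective w ∧ (∀ i, w i ∈ C i) ∧
      ∃ Q, Sys (EW G X (Finset.univ.image w)) B Y Q := by
  classical
  have hex : ∀ s : V, ∃ P : Option V → List (Option V), s ∈ Y →
      MinSys (Es G X s) (B.map Function.Embedding.some) (Finset.insertNone Y) P := by
    intro s
    by_cases hs : s ∈ Y
    · obtain ⟨P, hP⟩ := exists_minSys (twin_sys hconn hX hY hXY hBY hB hs)
      exact ⟨P, fun _ => hP⟩
    · exact ⟨fun _ => [], fun h => absurd h hs⟩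
  choose P hP using hex
  have htotE : ∀ s u v u' v', Es G X s u u' → Es G X s v v' → u ≠ v →
      Es G X s u v ∨ Es G X s v u := by
    intro s u v u' v' h1 h2 h3
    cases u with
    | none => exact absurd h1 (by simp [Es])
    | some u =>
      cases v with
      | none => exact absurd h2 (by simp [Es])
      | some v =>
        have hu : u ∉ X := by
          cases u' with
          | none => exact h1.2
          | some z => exact h1.2.1
        have hv : v ∉ X := by
          cases v' with
          | none => exact h2.2
          | some z => exact h2.2.1
        rcases htot u v (fun h => h3 (by rw [h])) with h | h
        · exact Or.inl ⟨h, hu, hv⟩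
        · exact Or.inr ⟨h, hv, hu⟩
  let r : V → V → Prop := fun u v => u = v ∨ ∃ s ∈ Y,
    (Bad (Es G X s) (P s) (Finset.insertNone Y) (some u) (some v) ∨
      (Consec (P s) (Finset.insertNone Y) (some u) (some v) ∨
        Consec (P s) (Finset.insertNone Y) (some v) (some u)))
  have hr : Few (1 + k * ((k + 1) * 4 + (1 + 1))) r := by
    apply few_or
    · exact few_functional (fun u v v' h1 h2 => h1.symm.trans h2)
    · rw [← hY]
      apply few_exists
      intro s hs
      have hM := hP s hs
      have h1 := few_some (few_bad hM (htotE s))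
      rw [Finset.card_insertNone] at h1
      exact few_or h1 (few_or (few_some (few_consec hM)) (few_flip (few_some (few_consec hM))))
  have hsymm : ∀ u v, r u v → r v u := by
    rintro u v (h | ⟨s, hs, h | h | h⟩)
    · exact Or.inl h.symm
    · exact Or.inr ⟨s, hs, Or.inl (bad_symm h)⟩
    · exact Or.inr ⟨s, hs, Or.inr (Or.inr h)⟩
    · exact Or.inr ⟨s, hs, Or.inr (Or.inl h)⟩
  have hne : Nonempty V := by
    have : 0 < B.card := by omega
    obtain ⟨b, _⟩ := Finset.card_pos.1 this
    exact ⟨b⟩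
  obtain ⟨w, hw, hw'⟩ := greedy hr hsymm k (Finset.univ : Finset (Fin k)) (by simp) n C
    (by simpa using hn) (fun i _ => hC i)
  have hw'' : ∀ i j, i ≠ j → ¬ r (w i) (w j) := fun i j h =>
    hw' i (Finset.mem_univ _) j (Finset.mem_univ _) h
  refine ⟨w, ?_, fun i => hw i (Finset.mem_univ _), ?_⟩
  · intro i j hij
    by_contra h
    exact hw'' i j h (Or.inl hij)
  · have himg : ∀ u ∈ Finset.univ.image w, ∀ v ∈ Finset.univ.image w, u ≠ v → ¬ r u v := by
      intro u hu v hv huv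
      simp only [Finset.mem_image, Finset.mem_univ, true_and] at hu hv
      obtain ⟨i, rfl⟩ := hu
      obtain ⟨j, rfl⟩ := hv
      exact hw'' i j (fun h => huv (by rw [h]))
    have hd : ∀ Z : Finset V, (∀ i, Disjoint (C i) Z) → Disjoint (Finset.univ.image w) Z := by
      intro Z hZ
      rw [Finset.disjoint_left]
      intro u hu
      simp only [Finset.mem_image, Finset.mem_univ, true_and] at hu
      obtain ⟨i, rfl⟩ := hu
      exact Finset.disjoint_left.1 (hZ i) (hw i (Finset.mem_univ _))
    apply w_lemma hXY (hd Y hCY) (hd B hCB) P hP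
    · intro s hs u hu v hv huv h
      exact himg u hu v hv huv (Or.inr ⟨s, hs, Or.inl h⟩)
    · intro s hs u hu v hv huv h
      exact himg u hu v hv huv (Or.inr ⟨s, hs, Or.inr (Or.inl h)⟩)

end TL


namespace TL

def Acc {V : Type} (G : V → V → Prop) (N m : ℕ) (b : V) : Prop :=
  ∀ (u : V) (Z : Finset V), Z.card ≤ N → u ∉ Z → b ∉ Z →
    ∃ p, Wk G p u b ∧ (∀ v ∈ p, v ∉ Z) ∧ p.length ≤ m

lemma Acc.mono {V : Type} {G : V → V → Prop} {N m m' : ℕ} {b : V} (h : Acc G N m b)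
    (hm : m ≤ m') : Acc G N m' b := by
  intro u Z h1 h2 h3
  obtain ⟨p, hp, hp', hl⟩ := h u Z h1 h2 h3
  exact ⟨p, hp, hp', hl.trans hm⟩

open Classical in
noncomputable def Out {V : Type} [Fintype V] (G : V → V → Prop) (v : V) : Finset V :=
  Finset.univ.filter (fun u => G v u)

lemma mem_Out {V : Type} [Fintype V] {G : V → V → Prop} {u v : V} : u ∈ Out G v ↔ G v u := by
  simp [Out]

lemma small_out {V : Type} [Fintype V] [DecidableEq V] {G : V → V → Prop}
    (hirr : ∀ v, ¬ G v v) (has : ∀ u v, G u v → ¬ G v u) (O : Finset V) (hO : O.Nonempty) :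
    ∃ w ∈ O, 2 * (Out G w ∩ O).card + 1 ≤ O.card := by
  classical
  have h1 : ∑ w ∈ O, (O.filter (fun u => G w u)).card = ∑ w ∈ O, (O.filter (fun u => G u w)).card :=
    Finset.sum_card_bipartiteAbove_eq_sum_card_bipartiteBelow (s := O) (t := O) G
  have h2 : ∀ w ∈ O, (O.filter (fun u => G w u)).card + (O.filter (fun u => G u w)).card ≤ O.card - 1 := by
    intro w hw
    rw [← Finset.card_erase_of_mem hw, ← Finset.card_union_of_disjoint]
    · apply Finset.card_le_card
      intro u hu
      rw [Finset.mem_union, Finset.mem_filter, Finset.mem_filter] at hu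
      rw [Finset.mem_erase]
      rcases hu with hu | hu
      · exact ⟨fun h => hirr w (by have := hu.2; rwa [h] at this), hu.1⟩
      · exact ⟨fun h => hirr w (by have := hu.2; rwa [h] at this), hu.1⟩
    · rw [Finset.disjoint_left]
      intro u hu hu'
      exact has _ _ (Finset.mem_filter.1 hu).2 (Finset.mem_filter.1 hu').2
  have h3 : ∑ w ∈ O, 2 * (O.filter (fun u => G w u)).card ≤ ∑ w ∈ O, (O.card - 1) := by
    calc ∑ w ∈ O, 2 * (O.filter (fun u => G w u)).card
        = ∑ w ∈ O, (O.filter (fun u => G w u)).card + ∑ w ∈ O, (O.filter (fun u => G w u)).card := by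
          rw [← Finset.mul_sum]; ring
      _ = ∑ w ∈ O, ((O.filter (fun u => G w u)).card + (O.filter (fun u => G u w)).card) := by
          rw [Finset.sum_add_distrib, ← h1]
      _ ≤ _ := Finset.sum_le_sum h2
  obtain ⟨w, hw, hle⟩ := Finset.exists_le_of_sum_le hO h3
  refine ⟨w, hw, ?_⟩
  have e : Out G w ∩ O = O.filter (fun u => G w u) := by
    ext u; simp [mem_Out, and_comm]
  rw [e]
  have := Finset.card_pos.2 hO
  omega

lemma hub_vertex {V : Type} [Fintype V] [DecidableEq V] [Nonempty V] {G : V → V → Prop}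
    (hirr : ∀ v, ¬ G v v) (has : ∀ u v, G u v → ¬ G v u) (htot : ∀ u v, u ≠ v → G u v ∨ G v u)
    {D N : ℕ} (hD : ∀ v, D ≤ (Out G v).card) (F : Finset V) (hF : F.card + 4 * N + 1 ≤ D) :
    ∃ v, v ∉ F ∧ Acc G N 5 v := by
  classical
  have hout : ∀ v, D - F.card ≤ (Out G v \ F).card := by
    intro v
    have := Finset.le_card_sdiff F (Out G v)
    have := hD v
    omega
  have hne : (Finset.univ \ F).Nonempty := by
    obtain ⟨v⟩ := (inferInstance : Nonempty V)
    have h1 := hout v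
    obtain ⟨u, hu⟩ := Finset.card_pos.1 (show 0 < (Out G v \ F).card by omega)
    exact ⟨u, by simpa using (Finset.mem_sdiff.1 hu).2⟩
  obtain ⟨v, hv, hmin⟩ := Finset.exists_min_image (Finset.univ \ F) (fun v => (Out G v \ F).card) hne
  have hvF : v ∉ F := by simpa using hv
  have hmin : ∀ u, u ∉ F → (Out G v \ F).card ≤ (Out G u \ F).card := fun u hu =>
    hmin u (by simpa using hu)
  set d := (Out G v \ F).card with hd
  have hdN : 4 * N + 1 ≤ d := by have := hout v; omega
  have main : ∀ (u : V) (Z : Finset V), u ∉ F → Z.card ≤ N → u ∉ Z → v ∉ Z →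
      ∃ p, Wk G p u v ∧ (∀ a ∈ p, a ∉ Z) ∧ p.length ≤ 4 := by
    intro u Z huF hZ hu hvZ
    by_contra hcon
    have c0 : u ≠ v := by
      rintro rfl
      exact hcon ⟨[u], wk_single G u, by simpa using hu, by simp⟩
    have c1 : ¬ G u v := fun h =>
      hcon ⟨[u, v], wk_cons (wk_single G v) h, by simp [hu, hvZ], by simp⟩
    have c2 : ∀ w, G u w → w ∉ Z → ¬ G w v := fun w h1 h2 h3 =>
      hcon ⟨[u, w, v], wk_cons (wk_cons (wk_single G v) h3) h1, by simp [hu, hvZ, h2], by simp⟩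
    have c3 : ∀ w w', G u w → w ∉ Z → G w w' → w' ∉ Z → ¬ G w' v := fun w w' h1 h2 h3 h4 h5 =>
      hcon ⟨[u, w, w', v], wk_cons (wk_cons (wk_cons (wk_single G v) h5) h3) h1,
        by simp [hu, hvZ, h2, h4], by simp⟩
    set O := Out G v \ F with hO
    set O' := (Out G u \ F) \ Z with hO'
    have hsub : O' ⊆ O := by
      intro w hw
      simp only [hO', Finset.mem_sdiff, mem_Out] at hw
      simp only [hO, Finset.mem_sdiff, mem_Out]
      refine ⟨(htot v w ?_).resolve_right (c2 w hw.1.1 hw.2), hw.1.2⟩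
      rintro rfl
      exact c1 hw.1.1
    have hO'c : d - N ≤ O'.card := by
      have h1 := Finset.le_card_sdiff Z (Out G u \ F)
      have h2 := hmin u huF
      rw [hO']
      omega
    have hO'le : O'.card ≤ d := Finset.card_le_card hsub
    obtain ⟨w, hw, hle⟩ := small_out hirr has O' (Finset.card_pos.1 (by omega))
    have hwm := hw
    simp only [hO', Finset.mem_sdiff, mem_Out] at hwm
    have h1 : (Out G w \ F) \ Z ⊆ (Out G w ∩ O') ∪ (O \ O') := by
      intro w' hw'
      simp only [Finset.mem_sdiff, mem_Out] at hw'
      have hO1 : w' ∈ O := by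
        simp only [hO, Finset.mem_sdiff, mem_Out]
        refine ⟨(htot v w' ?_).resolve_right (c3 w w' hwm.1.1 hwm.2 hw'.1.1 hw'.2), hw'.1.2⟩
        rintro rfl
        exact c2 w hwm.1.1 hwm.2 hw'.1.1
      by_cases hwO : w' ∈ O'
      · exact Finset.mem_union_left _ (Finset.mem_inter.2 ⟨mem_Out.2 hw'.1.1, hwO⟩)
      · exact Finset.mem_union_right _ (Finset.mem_sdiff.2 ⟨hO1, hwO⟩)
    have h2 := (Finset.card_le_card h1).trans (Finset.card_union_le _ _)
    have h3 := Finset.le_card_sdiff Z (Out G w \ F)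
    have h4 := hmin w hwm.1.2
    have h5 := Finset.card_sdiff_of_subset hsub
    omega
  refine ⟨v, hvF, ?_⟩
  intro u Z hZ hu hvZ
  by_cases huF : u ∈ F
  · have h1 := Finset.le_card_sdiff Z (Out G u \ F)
    have h2 := hout u
    obtain ⟨w, hw⟩ := Finset.card_pos.1 (show 0 < ((Out G u \ F) \ Z).card by omega)
    simp only [Finset.mem_sdiff, mem_Out] at hw
    obtain ⟨p, hp, hp', hl⟩ := main w Z hw.1.2 hZ hw.2 hvZ
    refine ⟨u :: p, wk_cons hp hw.1.1, ?_, by simp; omega⟩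
    intro a ha
    rcases List.mem_cons.1 ha with rfl | ha
    · exact hu
    · exact hp' a ha
  · obtain ⟨p, hp, hp', hl⟩ := main u Z huF hZ hu hvZ
    exact ⟨p, hp, hp', by omega⟩

lemma hub_set {V : Type} [Fintype V] [DecidableEq V] [Nonempty V] {G : V → V → Prop}
    (hirr : ∀ v, ¬ G v v) (has : ∀ u v, G u v → ¬ G v u) (htot : ∀ u v, u ≠ v → G u v ∨ G v u)
    {D N : ℕ} (hD : ∀ v, D ≤ (Out G v).card) (F : Finset V) (M : ℕ) :
    F.card + M + 4 * N + 1 ≤ D →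
    ∃ B : Finset V, B.card = M ∧ Disjoint B F ∧ ∀ b ∈ B, Acc G N 5 b := by
  induction M with
  | zero => intro _; exact ⟨∅, by simp⟩
  | succ M ih =>
    intro hF
    obtain ⟨B, hB, hBF, hBA⟩ := ih (by omega)
    obtain ⟨v, hv, hvA⟩ := hub_vertex hirr has htot hD (F ∪ B) (N := N) (by
      have := Finset.card_union_le F B
      omega)
    rw [Finset.mem_union] at hv
    push Not at hv
    refine ⟨insert v B, by rw [Finset.card_insert_of_notMem hv.2, hB], ?_, ?_⟩
    · rw [Finset.disjoint_insert_left]; exact ⟨hv.1, hBF⟩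
    · intro b hb
      rcases Finset.mem_insert.1 hb with rfl | hb
      · exact hvA
      · exact hBA b hb

lemma acc_closure {V : Type} [Fintype V] [DecidableEq V] {G : V → V → Prop} {N : ℕ}
    {B : Finset V} (hB : ∀ b ∈ B, Acc G N 5 b) {w : V} {I : Finset V} (hI : I ⊆ B)
    (hIw : ∀ b ∈ I, G b w) (hc : N + 1 ≤ I.card) : Acc G N 6 w := by
  intro u Z hZ hu hw
  have h1 := Finset.le_card_sdiff Z I
  obtain ⟨b, hb⟩ := Finset.card_pos.1 (show 0 < (I \ Z).card by omega)
  rw [Finset.mem_sdiff] at hb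
  obtain ⟨p, hp, hp', hl⟩ := hB b (hI hb.1) u Z hZ hu hb.2
  refine ⟨p ++ [w], wk_append_edge hp (wk_single G w) (hIw b hb.1), ?_, by simp; omega⟩
  intro v hv
  rcases List.mem_append.1 hv with hv | hv
  · exact hp' v hv
  · rw [List.mem_singleton] at hv; subst hv; exact hw

lemma half_bip {V : Type} [Fintype V] [DecidableEq V] {G : V → V → Prop} {S T : Finset V} {q n e : ℕ}
    (hS : S.card = q) (hT : T.card = q)
    (h : (S.filter (fun w => e ≤ (Out G w ∩ T).card)).card ≤ n) :
    ∑ w ∈ S, (Out G w ∩ T).card ≤ q * (n + e) := by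
  have h1 : ∀ w ∈ S, (Out G w ∩ T).card ≤ (if e ≤ (Out G w ∩ T).card then q else 0) + e := by
    intro w _
    split_ifs with h
    · have := Finset.card_le_card (Finset.inter_subset_right : Out G w ∩ T ⊆ T)
      omega
    · omega
  refine (Finset.sum_le_sum h1).trans ?_
  rw [Finset.sum_add_distrib, ← Finset.sum_filter, Finset.sum_const, Finset.sum_const, hS,
    smul_eq_mul, smul_eq_mul, mul_add, mul_comm]
  have := Nat.mul_le_mul_left q h
  omega

lemma bip {V : Type} [Fintype V] [DecidableEq V] {G : V → V → Prop}
    (htot : ∀ u v, u ≠ v → G u v ∨ G v u) {S T : Finset V} {q n e : ℕ} (hST : Disjoint S T)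
    (hS : S.card = q) (hT : T.card = q) (hq : 2 * (n + e) + 1 ≤ q) :
    n ≤ (S.filter (fun w => e ≤ (Out G w ∩ T).card)).card ∨
    n ≤ (T.filter (fun w => e ≤ (Out G w ∩ S).card)).card := by
  classical
  by_contra hcon
  push Not at hcon
  have h1 := half_bip hS hT hcon.1.le
  have h2 := half_bip hT hS hcon.2.le
  have h3 : ∑ w ∈ T, (Out G w ∩ S).card = ∑ w ∈ S, (T.filter (fun u => G u w)).card := by
    have := Finset.sum_card_bipartiteAbove_eq_sum_card_bipartiteBelow (s := T) (t := S) G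
    rw [show ∑ w ∈ S, (T.filter (fun u => G u w)).card = ∑ b ∈ S, (Finset.bipartiteBelow G T b).card
      from rfl, ← this]
    apply Finset.sum_congr rfl
    intro w _
    congr 1
    ext u
    simp [mem_Out, Finset.mem_bipartiteAbove, and_comm]
  have h4 : ∑ w ∈ S, q ≤ ∑ w ∈ S, ((Out G w ∩ T).card + (T.filter (fun u => G u w)).card) := by
    apply Finset.sum_le_sum
    intro w hw
    rw [← hT]
    refine le_trans (Finset.card_le_card ?_) (Finset.card_union_le _ _)
    intro u hu
    rw [Finset.mem_union, Finset.mem_inter, mem_Out, Finset.mem_filter]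
    have hne : w ≠ u := by
      rintro rfl
      exact Finset.disjoint_left.1 hST hw hu
    rcases htot w u hne with h | h
    · exact Or.inl ⟨h, hu⟩
    · exact Or.inr ⟨hu, h⟩
  rw [Finset.sum_add_distrib, ← h3, Finset.sum_const, hS, smul_eq_mul] at h4
  have h5 : q * q ≤ q * (2 * (n + e)) := by
    calc q * q ≤ _ := h4
      _ ≤ q * (n + e) + q * (n + e) := by omega
      _ = _ := by ring
  have h6 := Nat.le_of_mul_le_mul_left h5 (by omega)
  omega

lemma hub_step {V : Type} [Fintype V] [DecidableEq V] {G : V → V → Prop}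
    (htot : ∀ u v, u ≠ v → G u v ∨ G v u)
    {D N : ℕ} (hD : ∀ v, D ≤ (Out G v).card) {B0 F : Finset V} (hB0 : ∀ b ∈ B0, Acc G N 5 b)
    (hBF : B0 ⊆ F) {n e q : ℕ} (hB0c : e + N + 1 ≤ B0.card) (hq : 2 * (n + e) + 1 ≤ q)
    (hDF : F.card + n + 2 * q ≤ D) (x : V) :
    ∃ C B' : Finset V, C ⊆ Out G x ∧ C.card = n ∧ Disjoint C F ∧ Disjoint B' F ∧ Disjoint C B' ∧
      B'.card ≤ q ∧ (∀ b ∈ B', Acc G N 6 b) ∧ ∀ w ∈ C, e ≤ (Out G w ∩ (B0 ∪ B')).card := by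
  classical
  set A := Out G x \ F with hA
  have hAc : n + 2 * q ≤ A.card := by
    have := Finset.le_card_sdiff F (Out G x)
    have := hD x
    rw [hA]
    omega
  have hAF : Disjoint A F := Finset.sdiff_disjoint
  have hAO : A ⊆ Out G x := Finset.sdiff_subset
  by_cases hH : n ≤ (A.filter (fun w => e ≤ (Out G w ∩ B0).card)).card
  · obtain ⟨C, hC, hCn⟩ := Finset.exists_subset_card_eq hH
    have hCA : C ⊆ A := hC.trans (Finset.filter_subset _ _)
    refine ⟨C, ∅, hCA.trans hAO, hCn, Finset.disjoint_of_subset_left hCA hAF, by simp, by simp,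
      by simp, by simp, ?_⟩
    intro w hw
    simpa using (Finset.mem_filter.1 (hC hw)).2
  · push Not at hH
    have hc := Finset.card_filter_add_card_filter_not (s := A) (fun w => e ≤ (Out G w ∩ B0).card)
    set A' := A.filter (fun w => ¬ e ≤ (Out G w ∩ B0).card) with hA'
    have hA'A : A' ⊆ A := Finset.filter_subset _ _
    have hacc : ∀ w ∈ A', Acc G N 6 w := by
      intro w hw
      have h1 := (Finset.mem_filter.1 hw).2
      have hwF : w ∉ F := Finset.disjoint_left.1 hAF (hA'A hw)
      apply acc_closure hB0 (I := B0 \ Out G w) Finset.sdiff_subset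
      · intro b hb
        rw [Finset.mem_sdiff, mem_Out] at hb
        refine (htot b w ?_).resolve_right hb.2
        rintro rfl
        exact hwF (hBF hb.1)
      · have := Finset.card_sdiff_add_card_inter B0 (Out G w)
        rw [Finset.inter_comm] at this
        omega
    obtain ⟨S, hS, hSq⟩ := Finset.exists_subset_card_eq (show q ≤ A'.card by omega)
    have h2 := Finset.card_sdiff_of_subset hS
    obtain ⟨T, hT, hTq⟩ := Finset.exists_subset_card_eq (show q ≤ (A' \ S).card by omega)
    have hST : Disjoint S T := by
      rw [Finset.disjoint_left]
      intro a ha hb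
      exact (Finset.mem_sdiff.1 (hT hb)).2 ha
    have hTA : T ⊆ A' := hT.trans Finset.sdiff_subset
    have fin : ∀ S T : Finset V, Disjoint S T → S ⊆ A' → T ⊆ A' → T.card = q →
        n ≤ (S.filter (fun w => e ≤ (Out G w ∩ T).card)).card →
        ∃ C B' : Finset V, C ⊆ Out G x ∧ C.card = n ∧ Disjoint C F ∧ Disjoint B' F ∧ Disjoint C B' ∧
          B'.card ≤ q ∧ (∀ b ∈ B', Acc G N 6 b) ∧ ∀ w ∈ C, e ≤ (Out G w ∩ (B0 ∪ B')).card := by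
      intro S T hST hS hT hTq hn
      obtain ⟨C, hC, hCn⟩ := Finset.exists_subset_card_eq hn
      have hCS : C ⊆ S := hC.trans (Finset.filter_subset _ _)
      have hCA : C ⊆ A := (hCS.trans hS).trans hA'A
      refine ⟨C, T, hCA.trans hAO, hCn, Finset.disjoint_of_subset_left hCA hAF,
        Finset.disjoint_of_subset_left (hT.trans hA'A) hAF, Finset.disjoint_of_subset_left hCS hST,
        hTq.le, fun b hb => hacc b (hT hb), ?_⟩
      intro w hw
      refine (Finset.mem_filter.1 (hC hw)).2.trans (Finset.card_le_card ?_)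
      exact Finset.inter_subset_inter_left Finset.subset_union_right
    rcases bip htot hST hSq hTq hq with h | h
    · exact fin S T hST hS hTA hTq h
    · exact fin T S hST.symm hTA hS hSq h

lemma hub {V I : Type} [Fintype V] [DecidableEq V] [DecidableEq I] [Nonempty V] {G : V → V → Prop}
    (hirr : ∀ v, ¬ G v v) (has : ∀ u v, G u v → ¬ G v u) (htot : ∀ u v, u ≠ v → G u v ∨ G v u)
    {D N : ℕ} (hD : ∀ v, D ≤ (Out G v).card) (F0 : Finset V) {n e q M : ℕ}
    (hM : e + N + 1 ≤ M) (hq : 2 * (n + e) + 1 ≤ q) (h1 : F0.card + M + 4 * N + 1 ≤ D)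
    (x : I → V) (m : ℕ) (h2 : F0.card + M + m * (q + n) + n + 2 * q ≤ D) (J : Finset I) :
    J.card ≤ m → ∃ (B : Finset V) (C : I → Finset V), M ≤ B.card ∧ B.card ≤ M + J.card * q ∧
      Disjoint B F0 ∧ (∀ b ∈ B, Acc G N 6 b) ∧ ∀ i ∈ J, C i ⊆ Out G (x i) ∧ (C i).card = n ∧
        Disjoint (C i) F0 ∧ Disjoint (C i) B ∧ ∀ w ∈ C i, e ≤ (Out G w ∩ B).card := by
  classical
  obtain ⟨B0, hB0c, hB0F, hB0A⟩ := hub_set hirr has htot hD F0 M h1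
  suffices H : J.card ≤ m → ∃ (B : Finset V) (C : I → Finset V), B0 ⊆ B ∧ B.card ≤ M + J.card * q ∧
      Disjoint B F0 ∧ (∀ b ∈ B, Acc G N 6 b) ∧ ∀ i ∈ J, C i ⊆ Out G (x i) ∧ (C i).card = n ∧
        Disjoint (C i) F0 ∧ Disjoint (C i) B ∧ ∀ w ∈ C i, e ≤ (Out G w ∩ B).card by
    intro hJ
    obtain ⟨B, C, h, h'⟩ := H hJ
    exact ⟨B, C, hB0c ▸ Finset.card_le_card h, h'⟩
  induction J using Finset.induction_on with
  | empty =>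
    intro _
    exact ⟨B0, fun _ => ∅, le_rfl, by simp [hB0c], hB0F, fun b hb => (hB0A b hb).mono (by norm_num), by simp⟩
  | insert i0 J hi0 ih =>
    intro hJ
    rw [Finset.card_insert_of_notMem hi0] at hJ ⊢
    obtain ⟨B, C, hB1, hB2, hB3, hB4, hC⟩ := ih (by omega)
    set F := F0 ∪ B ∪ J.biUnion C with hF
    have hFc : F.card ≤ F0.card + M + J.card * q + J.card * n := by
      have e1 := Finset.card_union_le (F0 ∪ B) (J.biUnion C)
      have e2 := Finset.card_union_le F0 B
      have e3 : (J.biUnion C).card ≤ J.card * n :=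
        Finset.card_biUnion_le_card_mul _ _ _ (fun i hi => (hC i hi).2.1.le)
      rw [hF]
      omega
    have hmul : J.card * q + J.card * n ≤ m * (q + n) := by
      rw [← mul_add]; exact Nat.mul_le_mul_right _ (by omega)
    obtain ⟨C0, B', c1, c2, c3, c4, c5, c6, c7, c8⟩ := hub_step htot hD (F := F) hB0A
      (hB1.trans (Finset.subset_union_right.trans Finset.subset_union_left)) (n := n) (e := e) (q := q)
      (by omega) hq (by omega) (x i0)
    rw [hF, Finset.disjoint_union_right, Finset.disjoint_union_right] at c3 c4
    refine ⟨B ∪ B', Function.update C i0 C0, hB1.trans Finset.subset_union_left, ?_, ?_, ?_, ?_⟩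
    · have := Finset.card_union_le B B'
      rw [add_mul, one_mul]
      omega
    · rw [Finset.disjoint_union_left]; exact ⟨hB3, c4.1.1⟩
    · intro b hb
      rcases Finset.mem_union.1 hb with hb | hb
      · exact hB4 b hb
      · exact c7 b hb
    · intro i hi
      by_cases hii : i = i0
      · subst hii
        rw [Function.update_self]
        refine ⟨c1, c2, c3.1.1, Finset.disjoint_union_right.2 ⟨c3.1.2, c5⟩, ?_⟩
        intro w hw
        refine (c8 w hw).trans (Finset.card_le_card ?_)
        exact Finset.inter_subset_inter_left (Finset.union_subset_union_left hB1)
      · have hiJ : i ∈ J := (Finset.mem_insert.1 hi).resolve_left hii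
        rw [Function.update_of_ne hii]
        obtain ⟨d1, d2, d3, d4, d5⟩ := hC i hiJ
        refine ⟨d1, d2, d3, Finset.disjoint_union_right.2 ⟨d4, ?_⟩, ?_⟩
        · exact (Finset.disjoint_of_subset_right (Finset.subset_biUnion_of_mem C hiJ) c4.2).symm
        · intro w hw
          refine (d5 w hw).trans (Finset.card_le_card ?_)
          exact Finset.inter_subset_inter_left Finset.subset_union_left

end TL


namespace TL

lemma ew_mem {V : Type} [DecidableEq V] {G : V → V → Prop} {X W : Finset V} {l : List V} {b t : V}
    (h : Wk (EW G X W) l b t) (hb : b ∉ X ∧ b ∉ W) : ∀ v ∈ l, v ∉ X ∧ v ∉ W := by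
  intro v hv
  obtain ⟨i, hi⟩ := List.mem_iff_getElem?.1 hv
  cases i with
  | zero =>
    rw [← List.head?_eq_getElem?, h.2.1] at hi
    rw [← Option.some.inj hi]; exact hb
  | succ i =>
    have hlt : i + 1 < l.length := by
      by_contra hh
      rw [List.getElem?_eq_none (by omega)] at hi
      simp at hi
    have hi0 : l[i]? = some (l[i]'(by omega)) := by simp
    have := wk_edge h hi0 hi
    exact ⟨this.2.2.1, this.2.2.2.2⟩

lemma final_lemma {V : Type} [Fintype V] [DecidableEq V] {G : V → V → Prop} {k : ℕ}
    {x y w : Fin k → V} (hx : Function.Injective x) (hy : Function.Injective y)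
    (hw : Function.Injective w) {X Y W B : Finset V} (hXd : X = Finset.univ.image x)
    (hYd : Y = Finset.univ.image y) (hWd : W = Finset.univ.image w)
    (hBX : Disjoint B X) (hWX : Disjoint W X) (hWB : Disjoint W B)
    (hxw : ∀ i, G (x i) (w i)) {Q : V → List V} (hQ : MinSys (EW G X W) B Y Q)
    (hacc : ∀ b ∈ B, Acc G (14 * k) 6 b) (he : ∀ i, 14 * k + 1 ≤ (Out G (w i) ∩ B).card) :
    ∃ P : Fin k → List V, (∀ i, Wk G (P i) (x i) (y i) ∧ (P i).Nodup) ∧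
      ∀ i j, i ≠ j → ∀ v ∈ P i, v ∉ P j := by
  classical
  have hxX : ∀ i, x i ∈ X := by intro i; rw [hXd]; simp
  have hyY : ∀ i, y i ∈ Y := by intro i; rw [hYd]; simp
  have hwW : ∀ i, w i ∈ W := by intro i; rw [hWd]; simp
  have hXc : X.card ≤ k := by rw [hXd]; simpa using Finset.card_image_le (s := Finset.univ) (f := x)
  have hYc : Y.card ≤ k := by rw [hYd]; simpa using Finset.card_image_le (s := Finset.univ) (f := y)
  have hWc : W.card ≤ k := by rw [hWd]; simpa using Finset.card_image_le (s := Finset.univ) (f := w)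
  have hBn : ∀ b ∈ B, b ∉ X ∧ b ∉ W := fun b hb =>
    ⟨Finset.disjoint_left.1 hBX hb, fun h => Finset.disjoint_left.1 hWB h hb⟩
  have hQn : ∀ t ∈ Y, ∀ v ∈ Q t, v ∉ X ∧ v ∉ W := by
    intro t ht
    obtain ⟨b, hb, hwk⟩ := hQ.1.1 t ht
    exact ew_mem hwk (hBn b hb)
  have hhead : ∀ i, ∃ b ∈ B, Wk (EW G X W) (Q (y i)) b (y i) := fun i => hQ.1.1 _ (hyY i)
  choose c hcB hcW using hhead
  have hc0 : ∀ i, c i ∈ (Q (y i)).take 6 := by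
    intro i
    have h1 := (hcW i).2.1
    cases hl : Q (y i) with
    | nil => rw [hl] at h1; simp at h1
    | cons a l => rw [hl] at h1; simp at h1; simp [h1]
  have hcQ : ∀ i, c i ∈ Q (y i) := fun i => List.mem_of_mem_take (hc0 i)
  have step : ∀ J : Finset (Fin k), ∃ R : Fin k → List V,
      (∀ i ∈ J, (∃ b, Wk G (R i) b (c i) ∧ G (w i) b) ∧ (R i).length ≤ 6 ∧
        (∀ v ∈ R i, v ∉ X ∧ v ∉ W) ∧ (∀ v ∈ R i, ∀ t ∈ Y, v ∈ Q t → v = c i)) ∧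
      ∀ i ∈ J, ∀ j ∈ J, i ≠ j → ∀ v ∈ R i, v ∉ R j := by
    intro J
    induction J using Finset.induction_on with
    | empty => exact ⟨fun _ => [], by simp, by simp⟩
    | insert i0 J hi0 ih =>
      obtain ⟨R, hR, hRd⟩ := ih
      have hneJ : ∀ i ∈ J, i ≠ i0 := fun i hi h => hi0 (h ▸ hi)
      have hJc : J.card ≤ k := by simpa using Finset.card_le_univ J
      set Zf : Finset V := ((X ∪ W) ∪ Y.biUnion (fun t => ((Q t).take 6).toFinset)) ∪
        J.biUnion (fun j => (R j).toFinset) with hZf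
      have hZc : Zf.card ≤ 14 * k := by
        have e1 := Finset.card_union_le ((X ∪ W) ∪ Y.biUnion (fun t => ((Q t).take 6).toFinset))
          (J.biUnion (fun j => (R j).toFinset))
        have e2 := Finset.card_union_le (X ∪ W) (Y.biUnion (fun t => ((Q t).take 6).toFinset))
        have e3 := Finset.card_union_le X W
        have e4 : (Y.biUnion (fun t => ((Q t).take 6).toFinset)).card ≤ Y.card * 6 := by
          apply Finset.card_biUnion_le_card_mul
          intro t _
          refine (List.toFinset_card_le _).trans ?_
          simp
        have e5 : (J.biUnion (fun j => (R j).toFinset)).card ≤ J.card * 6 := by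
          apply Finset.card_biUnion_le_card_mul
          intro j hj
          exact (List.toFinset_card_le _).trans (hR j hj).2.1
        rw [hZf]
        omega
      have hZX : ∀ v ∈ X, v ∈ Zf := fun v hv => by simp [hZf, hv]
      have hZW : ∀ v ∈ W, v ∈ Zf := fun v hv => by simp [hZf, hv]
      have hZQ : ∀ t ∈ Y, ∀ v ∈ (Q t).take 6, v ∈ Zf := fun t ht v hv => by
        rw [hZf]
        refine Finset.mem_union_left _ (Finset.mem_union_right _ ?_)
        exact Finset.mem_biUnion.2 ⟨t, ht, List.mem_toFinset.2 hv⟩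
      have hZR : ∀ j ∈ J, ∀ v ∈ R j, v ∈ Zf := fun j hj v hv => by
        rw [hZf]
        refine Finset.mem_union_right _ ?_
        exact Finset.mem_biUnion.2 ⟨j, hj, List.mem_toFinset.2 hv⟩
      obtain ⟨b, hb, hbZ⟩ : ∃ b ∈ Out G (w i0) ∩ B, b ∉ Zf := by
        by_contra hcon
        push Not at hcon
        have h1 := Finset.card_le_card (show Out G (w i0) ∩ B ⊆ Zf from hcon)
        have h2 := he i0
        omega
      rw [Finset.mem_inter, mem_Out] at hb
      obtain ⟨p, hp, hpZ, hpl⟩ := hacc (c i0) (hcB i0) b (Zf.erase (c i0))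
        ((Finset.card_erase_le).trans hZc) (fun h => hbZ (Finset.mem_of_mem_erase h)) (by simp)
      have hpZ' : ∀ v ∈ p, v ∈ Zf → v = c i0 := by
        intro v hv hvZ
        by_contra hne
        exact hpZ v hv (Finset.mem_erase.2 ⟨hne, hvZ⟩)
      have hpn : ∀ v ∈ p, v ∉ X ∧ v ∉ W := by
        intro v hv
        refine ⟨fun h => ?_, fun h => ?_⟩
        · have := hpZ' v hv (hZX v h)
          subst this
          exact (hBn _ (hcB i0)).1 h
        · have := hpZ' v hv (hZW v h)
          subst this
          exact (hBn _ (hcB i0)).2 h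
      obtain ⟨l1, z, l2, hl, ⟨t, ht, hzt⟩, hl1⟩ := first_split (fun z => ∃ t ∈ Y, z ∈ Q t) p
        ⟨c i0, List.mem_of_getLast? hp.2.2, y i0, hyY i0, hcQ i0⟩
      have hz : p[l1.length]? = some z := by rw [hl]; simp
      have htake : p.take (l1.length + 1) = l1 ++ [z] := by
        rw [hl, List.take_length_add_append]; simp
      have hwk := wk_take hp _ hz
      rw [htake] at hwk
      have hsub : ∀ v ∈ l1 ++ [z], v ∈ p := by
        intro v hv
        rw [← htake] at hv
        exact List.mem_of_mem_take hv
      have hwkE : Wk (EW G X W) (l1 ++ [z]) b z := wk_mono hwk (fun u v hu hv huv =>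
        ⟨huv, (hpn u (hsub u hu)).1, (hpn v (hsub v hv)).1, (hpn u (hsub u hu)).2,
          (hpn v (hsub v hv)).2⟩)
      have hlen : l1.length + 1 ≤ 6 := by
        rw [hl] at hpl
        simp at hpl
        omega
      obtain ⟨a, ha⟩ := List.mem_iff_getElem?.1 hzt
      have hale := hQ.reroute ht hb.2 hwkE (fun s hs v hv hv' => hl1 v hv' ⟨s, hs, hv⟩) ha
      have hzc : z = c i0 := by
        apply hpZ' z (hsub z (by simp))
        apply hZQ t ht
        apply List.mem_of_getElem? (i := a)
        rw [List.getElem?_take, if_pos (by omega)]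
        exact ha
      subst hzc
      refine ⟨Function.update R i0 (l1 ++ [c i0]), ?_, ?_⟩
      · intro i hi
        rcases Finset.mem_insert.1 hi with rfl | hi
        · rw [Function.update_self]
          refine ⟨⟨b, hwk, hb.1⟩, by simpa using hlen, fun v hv => hpn v (hsub v hv), ?_⟩
          intro v hv s hs hvs
          rcases List.mem_append.1 hv with hv | hv
          · exact absurd ⟨s, hs, hvs⟩ (hl1 v hv)
          · simpa using hv
        · rw [Function.update_of_ne (hneJ i hi)]
          exact hR i hi
      · have key : ∀ j ∈ J, ∀ v ∈ l1 ++ [c i0], v ∉ R j := by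
          intro j hj v hv hvR
          have h1 := hpZ' v (hsub v hv) (hZR j hj v hvR)
          subst h1
          have h2 := (hR j hj).2.2.2 _ hvR (y i0) (hyY i0) (hcQ i0)
          have hne : y i0 ≠ y j := fun h => hi0 (hy h ▸ hj)
          exact hQ.1.2 _ (hyY i0) _ (hyY j) hne _ (hcQ i0) (h2 ▸ hcQ j)
        intro i hi j hj hij v hv
        rcases Finset.mem_insert.1 hi with hii | hi
        · have hj : j ∈ J := (Finset.mem_insert.1 hj).resolve_left (fun h => hij (hii.trans h.symm))
          rw [hii, Function.update_self] at hv
          rw [Function.update_of_ne (hneJ j hj)]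
          exact key j hj v hv
        · rw [Function.update_of_ne (hneJ i hi)] at hv
          rcases Finset.mem_insert.1 hj with hjj | hj
          · rw [hjj, Function.update_self]
            exact fun h => key i hi v h hv
          · rw [Function.update_of_ne (hneJ j hj)]
            exact hRd i hi j hj hij v hv
  obtain ⟨R, hR, hRd⟩ := step Finset.univ
  have hR := fun i => hR i (Finset.mem_univ i)
  have hRd := fun i j => hRd i (Finset.mem_univ i) j (Finset.mem_univ j)
  have hpath : ∀ i, ∃ l, Wk G l (x i) (y i) ∧ l.Nodup ∧
      ∀ v ∈ l, v = x i ∨ v = w i ∨ v ∈ R i ∨ v ∈ Q (y i) := by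
    intro i
    obtain ⟨⟨b, hb, hwb⟩, _⟩ := hR i
    have h1 : Wk G (Q (y i)) (c i) (y i) := wk_mono (hcW i) (fun u v _ _ h => h.1)
    obtain ⟨l, hl, hn, hs⟩ := wk_to_path (wk_cons (wk_cons (wk_trans hb h1) hwb) (hxw i))
    refine ⟨l, hl, hn, fun v hv => ?_⟩
    have := hs hv
    simp only [List.mem_cons, List.mem_append] at this
    rcases this with h | h | h | h
    · exact Or.inl h
    · exact Or.inr (Or.inl h)
    · exact Or.inr (Or.inr (Or.inl h))
    · exact Or.inr (Or.inr (Or.inr (List.mem_of_mem_tail h)))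
  choose P hP1 hP2 hP3 using hpath
  refine ⟨P, fun i => ⟨hP1 i, hP2 i⟩, ?_⟩
  intro i j hij v hv hv'
  have hxw' : ∀ i j, x i ≠ w j := fun i j h => Finset.disjoint_left.1 hWX (hwW j) (h ▸ hxX i)
  have hyne : y i ≠ y j := fun h => hij (hy h)
  rcases hP3 i v hv with rfl | rfl | h | h <;> rcases hP3 j _ hv' with h' | h' | h' | h'
  · exact hij (hx h')
  · exact hxw' _ _ h'
  · exact ((hR j).2.2.1 _ h').1 (hxX i)
  · exact (hQn _ (hyY j) _ h').1 (hxX i)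
  · exact hxw' _ _ h'.symm
  · exact hij (hw h')
  · exact ((hR j).2.2.1 _ h').2 (hwW i)
  · exact (hQn _ (hyY j) _ h').2 (hwW i)
  · rw [h'] at h; exact ((hR i).2.2.1 _ h).1 (hxX j)
  · rw [h'] at h; exact ((hR i).2.2.1 _ h).2 (hwW j)
  · exact hRd i j hij v h h'
  · have e := (hR i).2.2.2 v h _ (hyY j) h'
    rw [e] at h'
    exact hQ.1.2 _ (hyY i) _ (hyY j) hyne _ (hcQ i) h'
  · rw [h'] at h; exact (hQn _ (hyY i) _ h).1 (hxX j)
  · rw [h'] at h; exact (hQn _ (hyY i) _ h).2 (hwW j)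
  · have e := (hR j).2.2.2 v h' _ (hyY i) h
    rw [e] at h
    exact hQ.1.2 _ (hyY i) _ (hyY j) hyne _ h (hcQ j)
  · exact hQ.1.2 _ (hyY i) _ (hyY j) hyne v h h'

lemma connP_of {V : Type} [Fintype V] [DecidableEq V] {G : V → V → Prop} {k : ℕ}
    (h : StronglyKConnected G (2 * k + 1)) : ConnP G k := by
  intro R S hS x y hx hxS hy hyS
  obtain ⟨p, hp, h1, h2, h3⟩ := h.2 (S : Set V) (by rw [Set.ncard_coe_finset]; omega) x y
    (by simpa using hxS) (by simpa using hyS) (fun e => hx (e ▸ hy))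
  have hwk : Wk G p x y := ⟨hp.2.2, h1, h2⟩
  obtain ⟨u, v, hu, hv, huv, hA, hB⟩ := wk_enter (fun v => v ∈ R) hwk hx hy
  exact ⟨u, v, huv, by simpa using h3 u hu, hA, hB, by simpa using h3 v hv⟩

end TL

/-- There is an absolute constant `C > 0` such that every `(2k+1)`-strongly-connected
tournament with minimum out-degree at least `C * k^31` is `k`-linked. -/
theorem exists_const_pow31_linked :
    ∃ C : ℕ, 0 < C ∧ ∀ (k : ℕ) (V : Type) [Fintype V] (G : V → V → Prop),
      IsTournament G → StronglyKConnected G (2 * k + 1) →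
      (∀ v : V, C * k ^ 31 ≤ outDeg G v) → KLinked G k := by
  refine ⟨400, by norm_num, ?_⟩
  intro k V _ G hT hS hD
  classical
  refine ⟨by have := hS.1; omega, ?_⟩
  intro x y hxy
  rcases Nat.eq_zero_or_pos k with rfl | hk
  · exact ⟨fun _ => [], fun i => i.elim0, fun i => i.elim0⟩
  have hirr := hT.1
  have has : ∀ u v, G u v → ¬ G v u := by
    intro u v h
    have : u ≠ v := by rintro rfl; exact hirr _ h
    exact (hT.2 u v this).1 h
  have htot : ∀ u v, u ≠ v → G u v ∨ G v u := by
    intro u v h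
    by_cases h' : G v u
    · exact Or.inr h'
    · exact Or.inl ((hT.2 u v h).2 h')
  have hne : Nonempty V := ⟨x ⟨0, hk⟩⟩
  have hx : Function.Injective x := fun i j h => Sum.inl_injective (hxy (by simpa using h))
  have hy : Function.Injective y := fun i j h => Sum.inr_injective (hxy (by simpa using h))
  have hxney : ∀ i j, x i ≠ y j := fun i j h => by
    have := hxy (a₁ := Sum.inl i) (a₂ := Sum.inr j) (by simpa using h)
    simp at this
  have hDeg : ∀ v, 400 * k ^ 31 ≤ (TL.Out G v).card := by
    intro v
    refine (hD v).trans (le_of_eq ?_)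
    rw [outDeg, ← Set.ncard_coe_finset]
    congr 1
    ext u
    simp [TL.mem_Out]
  set X := Finset.univ.image x with hX
  set Y := Finset.univ.image y with hY
  have hXc : X.card = k := by rw [hX, Finset.card_image_of_injective _ hx]; simp
  have hYc : Y.card = k := by rw [hY, Finset.card_image_of_injective _ hy]; simp
  have hXY : Disjoint X Y := by
    rw [Finset.disjoint_left]
    intro v hv hv'
    simp only [hX, hY, Finset.mem_image, Finset.mem_univ, true_and] at hv hv'
    obtain ⟨i, rfl⟩ := hv
    obtain ⟨j, hj⟩ := hv'
    exact hxney i j hj.symm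
  have hF : (X ∪ Y).card ≤ 2 * k := by
    have := Finset.card_union_le X Y
    omega
  obtain ⟨n, hn⟩ : ∃ n, n = 2 * (1 + k * ((k + 1) * 4 + (1 + 1))) * k * k + 1 := ⟨_, rfl⟩
  have p1 : k ≤ k ^ 4 := by simpa using Nat.pow_le_pow_right hk (show 1 ≤ 4 by norm_num)
  have p2 : k ^ 4 ≤ k ^ 5 := Nat.pow_le_pow_right hk (by norm_num)
  have p3 : k ^ 5 ≤ k ^ 31 := Nat.pow_le_pow_right hk (by norm_num)
  have p4 : k ^ 3 ≤ k ^ 4 := Nat.pow_le_pow_right hk (by norm_num)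
  have p5 : k ^ 2 ≤ k ^ 4 := Nat.pow_le_pow_right hk (by norm_num)
  have hn' : n ≤ 23 * k ^ 4 := by
    have : n = 8 * k ^ 4 + 12 * k ^ 3 + 2 * k ^ 2 + 1 := by rw [hn]; ring
    omega
  obtain ⟨q, hq⟩ : ∃ q, q = 2 * (n + 15 * k) + 1 := ⟨_, rfl⟩
  have hq' : q ≤ 77 * k ^ 4 := by omega
  have hkq : k * (q + n) ≤ 100 * k ^ 5 := by
    calc k * (q + n) ≤ k * (100 * k ^ 4) := Nat.mul_le_mul_left _ (by omega)
      _ = 100 * k ^ 5 := by ring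
  obtain ⟨B, C, hB1, _, hB2, hB3, hC⟩ := TL.hub hirr has htot hDeg (N := 14 * k) (X ∪ Y) (n := n)
    (e := 15 * k) (q := q) (M := 30 * k) (by omega) (by omega) (by omega) x k (by omega)
    Finset.univ (by simp)
  have hC := fun i => hC i (Finset.mem_univ i)
  rw [Finset.disjoint_union_right] at hB2
  have hCXY := fun i => Finset.disjoint_union_right.1 (hC i).2.2.1
  obtain ⟨w, hw, hwC, Q0, hQ0⟩ := TL.exists_W htot (TL.connP_of hS) hXc hYc hXY hB2.2 (by omega) n
    (by omega) C (fun i => (hC i).2.1) (fun i => (hCXY i).2) (fun i => (hC i).2.2.2.1)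
  obtain ⟨Q, hQ⟩ := TL.exists_minSys ⟨Q0, hQ0⟩
  have hd : ∀ Z : Finset V, (∀ i, Disjoint (C i) Z) → Disjoint (Finset.univ.image w) Z := by
    intro Z hZ
    rw [Finset.disjoint_left]
    intro u hu
    simp only [Finset.mem_image, Finset.mem_univ, true_and] at hu
    obtain ⟨i, rfl⟩ := hu
    exact Finset.disjoint_left.1 (hZ i) (hwC i)
  obtain ⟨P, hP1, hP2⟩ := TL.final_lemma hx hy hw hX hY rfl hB2.1 (hd X (fun i => (hCXY i).1))
    (hd B (fun i => (hC i).2.2.2.1)) (fun i => TL.mem_Out.1 ((hC i).1 (hwC i))) hQ hB3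
    (fun i => le_trans (by omega) ((hC i).2.2.2.2 _ (hwC i)))
  refine ⟨P, fun i => ?_, hP2⟩
  obtain ⟨h1, h2⟩ := hP1 i
  exact ⟨⟨h1.ne_nil, h2, h1.1⟩, h1.2.1, h1.2.2⟩
end
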